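/- Let r ∈ ℕ, α ∈ (0,1], M = [a,b] a compact interval, and f : M → M an r-times continuously differentiable hyperbolic map with f({a,b}) ⊆ {a,b}. Then the locking set Lock(f, C^α(M,ℝ)) := {φ ∈ C^α(M,ℝ) : (f,φ) has the locking property with respect to C^α(M,ℝ)} is an open dense subset of C^α(M,ℝ). -/

import Mathlib

open MeasureTheory Set Filter

section HolderDefs

variable {X : Type*} [MetricSpace X]

/-- `φ` is `α`-Hölder on `S`. -/
def IsHolderOn (α : ℝ) (S : Set X) (φ : X → ℝ) : Prop :=
  ∃ C : ℝ, ∀ x ∈ S, ∀ y ∈ S, |φ x - φ y| ≤ C * dist x y ^ α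

/-- The `α`-Hölder seminorm of `φ` on `S`. -/
noncomputable def holderSemiOn (α : ℝ) (S : Set X) (φ : X → ℝ) : ℝ :=
  sInf {C : ℝ | 0 ≤ C ∧ ∀ x ∈ S, ∀ y ∈ S, |φ x - φ y| ≤ C * dist x y ^ α}

/-- The sup-norm of `φ` on `S`. -/
noncomputable def supNormOn (S : Set X) (φ : X → ℝ) : ℝ :=
  sSup ((fun x => |φ x|) '' S)

/-- The `α`-Hölder norm `‖φ‖_α = sup|φ| + ⌈φ⌉_α` on `S`. -/
noncomputable def holderNormOn (α : ℝ) (S : Set X) (φ : X → ℝ) : ℝ :=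
  supNormOn S φ + holderSemiOn α S φ

end HolderDefs

/-- `μ` is an `f`-invariant Borel probability measure for the dynamical system
`f` restricted to `S` (the measure gives full mass to `S`). -/
def IsInvProbOn (f : ℝ → ℝ) (S : Set ℝ) (μ : Measure ℝ) : Prop :=
  IsProbabilityMeasure μ ∧ μ S = 1 ∧
    ∀ B : Set ℝ, MeasurableSet B → μ (f ⁻¹' B ∩ S) = μ B

/-- The maximum ergodic average `Q(f, φ)` of the system `f` restricted to `S`. -/
noncomputable def maxErgAvgOn (f : ℝ → ℝ) (S : Set ℝ) (φ : ℝ → ℝ) : ℝ :=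
  sSup {r : ℝ | ∃ μ : Measure ℝ, IsInvProbOn f S μ ∧ r = ∫ x, φ x ∂μ}

/-- The set of `(f, φ)`-maximizing measures of the system `f` restricted to `S`. -/
def maxMeasuresOn (f : ℝ → ℝ) (S : Set ℝ) (φ : ℝ → ℝ) : Set (Measure ℝ) :=
  {μ : Measure ℝ | IsInvProbOn f S μ ∧ ∫ x, φ x ∂μ = maxErgAvgOn f S φ}

/-- The uniform probability measure `μ_O` on a finite set `O`. -/
noncomputable def orbitMeasure (O : Finset ℝ) : Measure ℝ :=
  (O.card : ENNReal)⁻¹ • ∑ x ∈ O, Measure.dirac x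

/-- The periodic optimization (PO) property for the system `f` restricted
to `S`. -/
def HasPOOn (f : ℝ → ℝ) (S : Set ℝ) (φ : ℝ → ℝ) : Prop :=
  ∃ x ∈ S, ∃ p : ℕ, 0 < p ∧ f^[p] x = x ∧
    maxMeasuresOn f S φ = {orbitMeasure ((Finset.range p).image fun i => f^[i] x)}

/-- The locking property of `(f, φ)` with respect to `C^α(S, ℝ)`. -/
def HasLockingOn (α : ℝ) (f : ℝ → ℝ) (S : Set ℝ) (φ : ℝ → ℝ) : Prop :=
  HasPOOn f S φ ∧ ∃ ε > (0:ℝ), ∀ ψ : ℝ → ℝ, IsHolderOn α S ψ →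
    holderNormOn α S (fun x => ψ x - φ x) < ε →
    maxMeasuresOn f S ψ = maxMeasuresOn f S φ

/-- `x` is an attracting periodic point of period `p` for the interval map `g`
on `I` (derivatives taken within `I`). -/
def IsAttractingPeriodicPt (g : ℝ → ℝ) (I : Set ℝ) (x : ℝ) (p : ℕ) : Prop :=
  x ∈ I ∧ 0 < p ∧ g^[p] x = x ∧ |derivWithin (g^[p]) I x| < 1

/-- The orbit of `x` under `g` converges to an attracting periodic orbit. -/
def OrbitConvergesToAttracting (g : ℝ → ℝ) (I : Set ℝ) (x : ℝ) : Prop :=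
  ∃ y p, IsAttractingPeriodicPt g I y p ∧
    Tendsto (fun n => Metric.infDist (g^[n] x) {z | ∃ i : ℕ, z = g^[i] y})
      atTop (nhds 0)

/-- The interval map `g : I → I` is hyperbolic with hyperbolic set `K`. -/
def IsHyperbolicOn (g : ℝ → ℝ) (I K : Set ℝ) : Prop :=
  IsCompact K ∧ K ⊆ I ∧ MapsTo g K K ∧
  (∃ c > (0:ℝ), ∃ θ₀ > (1:ℝ), ∀ x ∈ K, ∀ n : ℕ, 1 ≤ n →
    c * θ₀ ^ n ≤ |derivWithin (g^[n]) I x|) ∧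
  {x | ∃ p : ℕ, IsAttractingPeriodicPt g I x p}.Finite ∧
  ∀ x ∈ I \ K, OrbitConvergesToAttracting g I x

/-- A locally expanding map with local inverse branches at scale `η`: an open distance-expanding
map in quantitative form. -/
structure IsOpenExpanding {X : Type*} [MetricSpace X] (T : X → X) (lam η : ℝ) : Prop where
  one_lt : 1 < lam
  le_two : lam ≤ 2
  pos : 0 < η
  expand : ∀ x y, dist x y ≤ η → lam * dist x y ≤ dist (T x) (T y)
  lift : ∀ x y, dist (T x) y ≤ η → ∃ x', T x' = y ∧ lam * dist x x' ≤ dist (T x) y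

namespace IsOpenExpanding

variable {X : Type*} [MetricSpace X] {T : X → X} {lam η : ℝ}

theorem threshold_pos (hT : IsOpenExpanding T lam η) : 0 < (lam - 1) * η / 2 := by
  have := hT.one_lt
  have := hT.pos
  have : 0 < lam - 1 := by linarith
  positivity

theorem finite_shadow (hT : IsOpenExpanding T lam η) (N : ℕ) :
    ∀ w : ℕ → X, (∀ i, dist (T (w i)) (w (i + 1)) ≤ (lam - 1) * η / 2) →
      ∃ u, ∀ i ≤ N, dist (T^[i] u) (w i) ≤ η / 2 := by
  have h1 := hT.one_lt
  have h2 := hT.le_two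
  have h3 := hT.pos
  induction N with
  | zero =>
    intro w _
    refine ⟨w 0, fun i hi => ?_⟩
    obtain rfl : i = 0 := by omega
    simp only [Function.iterate_zero, id_eq, dist_self]
    positivity
  | succ N ih =>
    intro w hw
    obtain ⟨u, hu⟩ := ih (fun i => w (i + 1)) (fun i => hw (i + 1))
    have hu0 := hu 0 (Nat.zero_le _)
    simp only [Function.iterate_zero, id_eq, zero_add] at hu0
    have hd : dist (T (w 0)) u ≤ lam * (η / 2) := by
      have := dist_triangle (T (w 0)) (w 1) u
      have h4 := hw 0
      rw [dist_comm (w 1) u] at this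
      simp only [zero_add] at h4
      nlinarith
    obtain ⟨u', hu', hd'⟩ := hT.lift (w 0) u (by nlinarith)
    refine ⟨u', fun i hi => ?_⟩
    rcases i with _ | i
    · simp only [Function.iterate_zero, id_eq]
      rw [dist_comm]
      have : lam * dist (w 0) u' ≤ lam * (η / 2) := hd'.trans hd
      exact le_of_mul_le_mul_left this (by linarith)
    · rw [Function.iterate_succ_apply, hu']
      exact hu i (by omega)

theorem eq_of_dist_iterate_le (hT : IsOpenExpanding T lam η) {x y : X}
    (h : ∀ i, dist (T^[i] x) (T^[i] y) ≤ η) : x = y := by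
  have h1 := hT.one_lt
  have key : ∀ i : ℕ, lam ^ i * dist x y ≤ dist (T^[i] x) (T^[i] y) := by
    intro i
    induction i with
    | zero => simp
    | succ i ih =>
      rw [Function.iterate_succ_apply', Function.iterate_succ_apply']
      have := hT.expand _ _ (h i)
      calc lam ^ (i + 1) * dist x y = lam * (lam ^ i * dist x y) := by ring
        _ ≤ lam * dist (T^[i] x) (T^[i] y) := by gcongr
        _ ≤ _ := this
  by_contra hne
  have hpos : 0 < dist x y := dist_pos.2 hne
  obtain ⟨n, hn⟩ := pow_unbounded_of_one_lt (η / dist x y) h1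
  have := (key n).trans (h n)
  rw [div_lt_iff₀ hpos] at hn
  linarith

theorem exists_lift_iterate (hT : IsOpenExpanding T lam η) (n : ℕ) :
    ∀ x x', dist (T^[n] x) x' ≤ η → ∃ y, T^[n] y = x' ∧ dist x y ≤ dist (T^[n] x) x' ∧
      (lam - 1) * ∑ i ∈ Finset.range n, dist (T^[i] x) (T^[i] y) ≤
        dist (T^[n] x) x' - dist x y := by
  have h1 := hT.one_lt
  induction n with
  | zero => exact fun x x' _ => ⟨x', by simp⟩
  | succ n ih =>
    intro x x' h
    obtain ⟨y, hy, hd, hs⟩ := ih (T x) x' h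
    obtain ⟨y', hy', hd'⟩ := hT.lift x y (hd.trans h)
    rw [Function.iterate_succ_apply]
    have h0 : 0 ≤ dist x y' := dist_nonneg
    refine ⟨y', by rw [Function.iterate_succ_apply, hy', hy], ?_, ?_⟩
    · nlinarith
    · rw [Finset.sum_range_succ']
      simp only [Function.iterate_succ_apply, hy', Function.iterate_zero, id_eq]
      nlinarith

theorem closing [CompactSpace X] (hT : IsOpenExpanding T lam η) (hc : Continuous T) {n : ℕ}
    {w : ℕ → X} (hper : ∀ i, w (i + n) = w i)
    (hw : ∀ i, dist (T (w i)) (w (i + 1)) ≤ (lam - 1) * η / 2) :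
    ∃ z, T^[n] z = z ∧
      (lam - 1) * ∑ i ∈ Finset.range n, dist (T^[i] z) (w i) ≤
        ∑ i ∈ Finset.range n, dist (T (w i)) (w (i + 1)) := by
  have h3 := hT.pos
  choose u hu using fun N => hT.finite_shadow N w hw
  obtain ⟨z, φ, hφ, hz⟩ := CompactSpace.tendsto_subseq u
  have hsh : ∀ i, dist (T^[i] z) (w i) ≤ η / 2 := by
    intro i
    have ht : Tendsto (fun k => dist (T^[i] (u (φ k))) (w i)) atTop (nhds (dist (T^[i] z) (w i))) :=
      (((hc.iterate i).tendsto z).comp hz).dist tendsto_const_nhds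
    refine le_of_tendsto ht ?_
    filter_upwards [eventually_ge_atTop i] with k hk
    exact hu _ i (hk.trans (hφ.id_le k))
  have hzn : T^[n] z = z := by
    refine hT.eq_of_dist_iterate_le fun i => ?_
    rw [← Function.iterate_add_apply]
    have h4 := hsh (i + n)
    rw [hper] at h4
    have h5 := hsh i
    have := dist_triangle_right (T^[i + n] z) (T^[i] z) (w i)
    linarith
  refine ⟨z, hzn, ?_⟩
  have hstep : ∀ i, lam * dist (T^[i] z) (w i) ≤
      dist (T^[i + 1] z) (w (i + 1)) + dist (T (w i)) (w (i + 1)) := by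
    intro i
    have h4 := hT.expand (T^[i] z) (w i) ((hsh i).trans (by linarith))
    rw [← Function.iterate_succ_apply' T] at h4
    exact h4.trans (dist_triangle_right _ _ _)
  have hsum := Finset.sum_le_sum fun i (_ : i ∈ Finset.range n) => hstep i
  rw [← Finset.mul_sum, Finset.sum_add_distrib] at hsum
  have hshift : ∑ i ∈ Finset.range n, dist (T^[i + 1] z) (w (i + 1)) =
      ∑ i ∈ Finset.range n, dist (T^[i] z) (w i) := by
    have e1 := Finset.sum_range_succ (fun i => dist (T^[i] z) (w i)) n
    have e2 := Finset.sum_range_succ' (fun i => dist (T^[i] z) (w i)) n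
    have e3 := hper 0
    simp only [hzn, Function.iterate_zero, id_eq] at e1 e2
    rw [zero_add] at e3
    rw [e3] at e1
    linarith
  rw [hshift] at hsum
  linarith

theorem sum_range_mul_le {g : ℕ → ℝ} {e : ℝ} {m : ℕ}
    (h : ∀ j, ∑ i ∈ Finset.range m, g (j * m + i) ≤ e) (l : ℕ) :
    ∑ i ∈ Finset.range (l * m), g i ≤ l * e := by
  induction l with
  | zero => simp
  | succ l ih =>
    rw [Nat.succ_mul, Finset.sum_range_add]
    push_cast
    linarith [h l]

theorem closing_blocks [CompactSpace X] (hT : IsOpenExpanding T lam η) (hc : Continuous T)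
    {l m : ℕ} (hm : 0 < m) {x : ℕ → X} (hx : ∀ j, x (j + l) = x j) {e : ℝ}
    (he : ∀ j, dist (T^[m] (x j)) (x (j + 1)) ≤ e) (hthr : e ≤ (lam - 1) * η / 2) :
    ∃ z, T^[l * m] z = z ∧
      (lam - 1) * ∑ i ∈ Finset.range (l * m), dist (T^[i] z) (T^[i % m] (x (i / m))) ≤ l * e := by
  set w : ℕ → X := fun i => T^[i % m] (x (i / m)) with hwdef
  have hw1 : ∀ j i, i < m → w (j * m + i) = T^[i] (x j) := by
    intro j i hi
    simp only [hwdef]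
    rw [show (j * m + i) % m = i by rw [mul_comm, Nat.mul_add_mod, Nat.mod_eq_of_lt hi],
      show (j * m + i) / m = j by rw [mul_comm, Nat.mul_add_div hm, Nat.div_eq_of_lt hi, add_zero]]
  have he0 : 0 ≤ e := dist_nonneg.trans (he 0)
  have hstep : ∀ j i, i < m → dist (T (w (j * m + i))) (w (j * m + i + 1)) ≤
      if i = m - 1 then e else 0 := by
    intro j i hi
    rw [hw1 j i hi, ← Function.iterate_succ_apply' T]
    split_ifs with him
    · have : j * m + i + 1 = (j + 1) * m + 0 := by rw [him, Nat.succ_mul]; omega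
      rw [this, hw1 _ 0 hm, show i.succ = m by omega]
      exact he j
    · rw [add_assoc, hw1 j (i + 1) (by omega), dist_self]
  obtain ⟨z, hz, hsum⟩ := hT.closing (n := l * m) (w := w) hc
    (by
      intro i
      simp only [hwdef]
      rw [Nat.add_mul_mod_self_right, Nat.add_mul_div_right _ _ hm, hx])
    (by
      intro i
      have h4 := hstep (i / m) (i % m) (Nat.mod_lt _ hm)
      rw [Nat.div_add_mod'] at h4
      refine h4.trans ?_
      split_ifs
      · exact hthr
      · exact hT.threshold_pos.le)
  refine ⟨z, hz, hsum.trans ?_⟩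
  refine sum_range_mul_le (g := fun i => dist (T (w i)) (w (i + 1))) (fun j => ?_) l
  calc _ ≤ ∑ i ∈ Finset.range m, (if i = m - 1 then e else 0) :=
        Finset.sum_le_sum fun i hi => hstep j i (Finset.mem_range.1 hi)
    _ = e := by simp [hm]

theorem closing_return [CompactSpace X] (hT : IsOpenExpanding T lam η) (hc : Continuous T)
    {l : ℕ} (hl : 0 < l) {x : X} (hx : dist (T^[l] x) x ≤ (lam - 1) * η / 2) :
    ∃ z, T^[l] z = z ∧
      (lam - 1) * ∑ i ∈ Finset.range l, dist (T^[i] z) (T^[i] x) ≤ dist (T^[l] x) x := by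
  obtain ⟨z, hz, h⟩ := hT.closing_blocks hc (l := 1) hl (x := fun _ => x) (fun _ => rfl)
    (fun _ => le_rfl) hx
  rw [one_mul] at hz h
  refine ⟨z, hz, ?_⟩
  rw [Nat.cast_one, one_mul] at h
  convert h using 4 with i hi
  rw [Nat.mod_eq_of_lt (Finset.mem_range.1 hi)]

end IsOpenExpanding

theorem continuous_of_abs_sub_le {X : Type*} [PseudoMetricSpace X] {g : X → ℝ} {C : ℝ}
    (hg : ∀ x y, |g x - g y| ≤ C * dist x y) : Continuous g :=
  (LipschitzWith.of_dist_le' (K := C) fun x y => by rw [Real.dist_eq]; exact hg x y).continuous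

theorem exists_fin_coloring (X : Type*) [MetricSpace X] [CompactSpace X] {δ : ℝ} (hδ : 0 < δ) :
    ∃ (q : ℕ) (c : X → Fin q), ∀ x y, c x = c y → dist x y ≤ δ := by
  obtain ⟨t, -, htf, ht⟩ := finite_cover_balls_of_compact (isCompact_univ (X := X)) (half_pos hδ)
  have : ∀ x : X, ∃ y : htf.toFinset, dist x y < δ / 2 := by
    intro x
    obtain ⟨y, hy, hxy⟩ := mem_iUnion₂.1 (ht (mem_univ x))
    exact ⟨⟨y, htf.mem_toFinset.2 hy⟩, hxy⟩
  choose c hc using this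
  refine ⟨_, fun x => htf.toFinset.equivFin (c x), fun x y hxy => ?_⟩
  have hxy' := htf.toFinset.equivFin.injective hxy
  have h1 := hc x
  have h2 := hc y
  rw [← hxy'] at h2
  linarith [dist_triangle_right x y (c x : X)]

theorem abs_birkhoffSum_sub_le {X : Type*} [PseudoMetricSpace X] {T : X → X} {g : X → ℝ} {C : ℝ}
    (hg : ∀ x y, |g x - g y| ≤ C * dist x y) (n : ℕ) (x y : X) :
    |birkhoffSum T g n x - birkhoffSum T g n y| ≤
      C * ∑ i ∈ Finset.range n, dist (T^[i] x) (T^[i] y) := by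
  rw [birkhoffSum, birkhoffSum, ← Finset.sum_sub_distrib, Finset.mul_sum]
  exact (Finset.abs_sum_le_sum_abs _ _).trans (Finset.sum_le_sum fun i _ => hg _ _)

theorem birkhoffSum_coboundary {X : Type*} (T : X → X) (h : X → ℝ) (n : ℕ) (x : X) :
    birkhoffSum T (fun y => h y - h (T y)) n x = h x - h (T^[n] x) := by
  induction n with
  | zero => simp
  | succ n ih =>
    rw [birkhoffSum_succ, ih, Function.iterate_succ_apply']
    ring

theorem birkhoffSum_const_real {X : Type*} (T : X → X) (c : ℝ) (n : ℕ) (x : X) :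
    birkhoffSum T (fun _ => c) n x = n * c := by
  simp [birkhoffSum]

theorem iterate_mul_of_iterate_eq {X : Type*} {T : X → X} {n : ℕ} {x : X} (hx : T^[n] x = x)
    (k : ℕ) : T^[k * n] x = x := by
  rw [mul_comm, Function.iterate_mul]
  exact Function.iterate_fixed hx k

theorem birkhoffSum_mul_of_iterate_eq {X : Type*} {T : X → X} {n : ℕ} {x : X} (hx : T^[n] x = x)
    (g : X → ℝ) (k : ℕ) : birkhoffSum T g (k * n) x = k * birkhoffSum T g n x := by
  induction k with
  | zero => simp
  | succ k ih =>
    rw [Nat.succ_mul, birkhoffSum_add, ih, iterate_mul_of_iterate_eq hx]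
    push_cast
    ring

namespace IsOpenExpanding

variable {X : Type*} [MetricSpace X] [CompactSpace X] {T : X → X} {lam η : ℝ}

theorem exists_periodic [Nonempty X] (hT : IsOpenExpanding T lam η) (hc : Continuous T) :
    ∃ n z, 0 < n ∧ T^[n] z = z := by
  obtain ⟨q, c, hcol⟩ := exists_fin_coloring X hT.threshold_pos
  obtain ⟨x⟩ := ‹Nonempty X›
  obtain ⟨i, j, hij, h⟩ := Finite.exists_ne_map_eq_of_infinite fun i => c (T^[i] x)
  wlog hlt : i < j generalizing i j
  · exact this j i hij.symm h.symm (by omega)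
  have hd := hcol _ _ h.symm
  have e1 : T^[j] x = T^[j - i] (T^[i] x) := by
    rw [← Function.iterate_add_apply]
    congr 1
    omega
  rw [e1] at hd
  obtain ⟨z, hz, -⟩ := hT.closing_return hc (by omega) hd
  exact ⟨j - i, z, by omega, hz⟩

theorem exists_birkhoffSum_le (hT : IsOpenExpanding T lam η) (hc : Continuous T) {g : X → ℝ}
    {C : ℝ} (hg : ∀ x y, |g x - g y| ≤ C * dist x y)
    (hper : ∀ n x, 0 < n → T^[n] x = x → birkhoffSum T g n x ≤ 0) :
    ∃ B, ∀ n x, birkhoffSum T g n x ≤ B := by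
  rcases isEmpty_or_nonempty X with hX | hX
  · exact ⟨0, fun n x => hX.elim x⟩
  obtain ⟨q, c, hcol⟩ := exists_fin_coloring X hT.threshold_pos
  have hgc := continuous_of_abs_sub_le hg
  obtain ⟨M, hM⟩ := (isCompact_univ.image hgc).bddAbove
  have hM' : ∀ x, g x ≤ M := fun x => hM ⟨x, mem_univ _, rfl⟩
  have h1 : 0 < lam - 1 := by linarith [hT.one_lt]
  have hη := hT.pos
  have hret : ∀ t x, dist (T^[t] x) x ≤ (lam - 1) * η / 2 →
      birkhoffSum T g t x ≤ |C| * η := by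
    intro t x hx
    rcases Nat.eq_zero_or_pos t with rfl | ht
    · simp; positivity
    obtain ⟨z, hz, hsum⟩ := hT.closing_return hc ht hx
    have h2 := hper t z ht hz
    have h3 := abs_birkhoffSum_sub_le (T := T) hg t z x
    have h4 : ∑ i ∈ Finset.range t, dist (T^[i] z) (T^[i] x) ≤ η := by
      have : (lam - 1) * ∑ i ∈ Finset.range t, dist (T^[i] z) (T^[i] x) ≤ (lam - 1) * η := by
        linarith [mul_pos h1 hη]
      exact le_of_mul_le_mul_left this h1
    have h5 : C * ∑ i ∈ Finset.range t, dist (T^[i] z) (T^[i] x) ≤ |C| * η :=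
      mul_le_mul (le_abs_self C) h4 (Finset.sum_nonneg fun _ _ => dist_nonneg) (abs_nonneg _)
    linarith [neg_le_of_abs_le h3]
  have hB : 0 ≤ |C| * η + |M| := by positivity
  have key : ∀ k : ℕ, ∀ U : Finset (Fin q), U.card ≤ k → ∀ n x,
      (∀ i < n, c (T^[i] x) ∈ U) → birkhoffSum T g n x ≤ k * (|C| * η + |M|) := by
    intro k
    induction k with
    | zero =>
      intro U hU n x h
      rcases Nat.eq_zero_or_pos n with rfl | hn
      · simp
      · have := h 0 hn
        rw [Finset.card_eq_zero.1 (Nat.le_zero.1 hU)] at this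
        simp at this
    | succ k ih =>
      intro U hU n x h
      rcases Nat.eq_zero_or_pos n with rfl | hn
      · simp; positivity
      set t := Nat.findGreatest (fun i => c (T^[i] x) = c x) (n - 1) with ht
      have htn : t ≤ n - 1 := Nat.findGreatest_le _
      have htx : c (T^[t] x) = c x :=
        Nat.findGreatest_spec (P := fun i => c (T^[i] x) = c x) (Nat.zero_le _) rfl
      have hlast : ∀ i, t < i → i ≤ n - 1 → c (T^[i] x) ≠ c x :=
        fun i h1 h2 => Nat.findGreatest_is_greatest h1 h2
      obtain ⟨r, hr⟩ : ∃ r, n = t + (1 + r) := ⟨n - t - 1, by omega⟩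
      rw [hr, birkhoffSum_add, birkhoffSum_add, birkhoffSum_one]
      have e1 := hret t x (hcol _ _ htx)
      have e2 := (hM' (T^[t] x)).trans (le_abs_self M)
      have e3 := ih (U.erase (c x)) (by
          rw [Finset.card_erase_of_mem (show c x ∈ U from h 0 hn)]; omega) r (T^[1] (T^[t] x)) (by
          intro i hi
          rw [← Function.iterate_add_apply, ← Function.iterate_add_apply]
          exact Finset.mem_erase.2 ⟨hlast _ (by omega) (by omega), h _ (by omega)⟩)
      push_cast
      linarith
  exact ⟨_, fun n x => key _ Finset.univ le_rfl n x fun _ _ => Finset.mem_univ _⟩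

theorem exists_subaction (hT : IsOpenExpanding T lam η) (hc : Continuous T) {g : X → ℝ}
    {C : ℝ} (hC : 0 ≤ C) (hg : ∀ x y, |g x - g y| ≤ C * dist x y)
    (hper : ∀ n x, 0 < n → T^[n] x = x → birkhoffSum T g n x ≤ 0) :
    ∃ (h : X → ℝ) (D : ℝ), 0 ≤ D ∧ (∀ x y, |h x - h y| ≤ D * dist x y) ∧
      ∀ x, g x + h x - h (T x) ≤ 0 := by
  obtain ⟨B, hB⟩ := hT.exists_birkhoffSum_le hc hg hper
  have h1 : 0 < lam - 1 := by linarith [hT.one_lt]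
  have hη := hT.pos
  set S : X → Set ℝ := fun x => {s | ∃ n y, T^[n] y = x ∧ s = birkhoffSum T g n y} with hS
  have hne : ∀ x, (S x).Nonempty := fun x => ⟨0, 0, x, rfl, by simp⟩
  have hbdd : ∀ x, BddAbove (S x) := fun x => ⟨B, by rintro _ ⟨n, y, -, rfl⟩; exact hB n y⟩
  set h : X → ℝ := fun x => sSup (S x) with hh
  have hh0 : ∀ x, 0 ≤ h x := fun x => le_csSup (hbdd x) ⟨0, x, rfl, by simp⟩
  have hhB : ∀ x, h x ≤ B := fun x =>
    csSup_le (hne x) (by rintro _ ⟨n, y, -, rfl⟩; exact hB n y)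
  have hB0 : ∀ x : X, 0 ≤ B := fun x => (hh0 x).trans (hhB x)
  have hone : ∀ x x', h x - h x' ≤ (C / (lam - 1) + |B| / η) * dist x x' := by
    intro x x'
    rcases le_or_gt (dist x x') η with hd | hd
    · have : h x ≤ h x' + C / (lam - 1) * dist x x' := by
        refine csSup_le (hne x) ?_
        rintro _ ⟨n, y, hy, rfl⟩
        obtain ⟨y', hy', hd1, hd2⟩ := hT.exists_lift_iterate n y x' (by rwa [hy])
        rw [hy] at hd2
        have e1 := le_of_abs_le (abs_birkhoffSum_sub_le (T := T) hg n y y')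
        have e2 : birkhoffSum T g n y' ≤ h x' := le_csSup (hbdd x') ⟨n, y', hy', rfl⟩
        have e3 : ∑ i ∈ Finset.range n, dist (T^[i] y) (T^[i] y') ≤ dist x x' / (lam - 1) := by
          rw [le_div_iff₀ h1]
          linarith [dist_nonneg (x := y) (y := y')]
        have e4 := mul_le_mul_of_nonneg_left e3 hC
        have e5 : C * (dist x x' / (lam - 1)) = C / (lam - 1) * dist x x' := by ring
        linarith
      have : 0 ≤ |B| / η * dist x x' := by positivity
      linarith
    · have e1 : h x - h x' ≤ |B| := by linarith [hh0 x', hhB x, le_abs_self B]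
      have e2 : |B| ≤ |B| / η * dist x x' := by
        rw [div_mul_eq_mul_div, le_div_iff₀ hη]
        exact mul_le_mul_of_nonneg_left hd.le (abs_nonneg _)
      have : 0 ≤ C / (lam - 1) * dist x x' := by positivity
      linarith
  refine ⟨h, C / (lam - 1) + |B| / η, by positivity, fun x y => ?_, fun x => ?_⟩
  · rw [abs_sub_le_iff]
    exact ⟨hone x y, by rw [dist_comm]; exact hone y x⟩
  · have : h x ≤ h (T x) - g x := by
      refine csSup_le (hne x) ?_
      rintro _ ⟨n, y, hy, rfl⟩
      have : birkhoffSum T g (n + 1) y ≤ h (T x) :=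
        le_csSup (hbdd _) ⟨n + 1, y, by rw [Function.iterate_succ_apply', hy], rfl⟩
      rw [birkhoffSum_succ, hy] at this
      linarith
    linarith

end IsOpenExpanding

/-- A graph without closed walks of length at most `k` has at most `(#V).choose k` walks with `k`
vertices, since such a walk is determined by its set of vertices. -/
theorem card_walks_le_choose {V : Type*} [DecidableEq V] (R : V → V → Prop) (k : ℕ)
    (hno : ∀ l, 0 < l → l ≤ k → ∀ c : ℕ → V, (∀ i < l, R (c i) (c (i + 1))) → c l ≠ c 0)
    (A : Finset V) (S : Finset (Fin k → V)) (hSA : ∀ u ∈ S, ∀ i, u i ∈ A)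
    (hS : ∀ u ∈ S, ∀ i j : Fin k, (i : ℕ) + 1 = j → R (u i) (u j)) :
    S.card ≤ A.card.choose k := by
  have hback : ∀ u ∈ S, ∀ i j : Fin k, i ≤ j → ¬ R (u j) (u i) := by
    intro u hu i j hij hR
    have hi := i.2
    have hj := j.2
    have hij' : (i : ℕ) ≤ j := hij
    set l := (j : ℕ) - i + 1 with hl
    have hlt : ∀ t, i + t % l < k := fun t => by
      have := Nat.mod_lt t (show l > 0 by omega)
      omega
    refine hno l (by omega) (by omega) (fun t => u ⟨i + t % l, hlt t⟩) (fun t ht => ?_) (by simp)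
    rcases Nat.lt_or_ge (t + 1) l with h | h
    · refine hS u hu _ _ ?_
      simp only [Nat.mod_eq_of_lt h, Nat.mod_eq_of_lt ht]
      omega
    · have ht1 : t + 1 = l := by omega
      convert hR using 2
      · ext
        simp only [Nat.mod_eq_of_lt ht]
        omega
      · ext
        simp [ht1]
  rw [← Finset.card_powersetCard]
  refine Finset.card_le_card_of_injOn (fun u => Finset.univ.image u) (fun u hu => ?_) ?_
  · have hinj : Function.Injective u := by
      intro i j hij
      by_contra hne
      wlog hlt : i < j generalizing i j
      · exact this hij.symm (Ne.symm hne) (lt_of_le_of_ne (not_lt.1 hlt) (Ne.symm hne))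
      have hj : (j : ℕ) - 1 < k := by omega
      have hlt' : (i : ℕ) < j := hlt
      refine hback u hu i ⟨j - 1, hj⟩ (by rw [Fin.le_def]; simp only; omega) ?_
      rw [hij]
      exact hS u hu _ _ (by simp only; omega)
    rw [Finset.mem_coe, Finset.mem_powersetCard]
    refine ⟨Finset.image_subset_iff.2 fun i _ => hSA u hu i, ?_⟩
    rw [Finset.card_image_of_injective _ hinj, Finset.card_univ, Fintype.card_fin]
  · intro u hu v hv huv
    have hσ : ∀ i, ∃ j, u j = v i := by
      intro i
      have : v i ∈ Finset.univ.image u := by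
        simp only at huv
        rw [huv]
        exact Finset.mem_image_of_mem _ (Finset.mem_univ _)
      simpa using this
    choose σ hσ using hσ
    rcases k with _ | k
    · exact Subsingleton.elim _ _
    have hmono : StrictMono σ := by
      rw [Fin.strictMono_iff_lt_succ]
      intro i
      by_contra hle
      refine hback u hu _ _ (not_lt.1 hle) ?_
      rw [hσ, hσ]
      exact hS v hv _ _ (by simp)
    have hid : σ = id := le_antisymm hmono.le_id hmono.id_le
    funext i
    rw [← hσ, hid, id]

/-- The itinerary of length `m` of the point `x` with respect to the coloring `c`. -/
def itinerary {X : Type*} {q : ℕ} (T : X → X) (c : X → Fin q) (m : ℕ) (x : X) : Fin m → Fin q :=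
  fun i => c (T^[i] x)

section Itinerary

variable {X : Type*} {q : ℕ} {T : X → X} {c : X → Fin q} {Z : Set X}

theorem itinerary_ncard_pos (hZ : Z.Nonempty) (m : ℕ) : 0 < (itinerary T c m '' Z).ncard :=
  (Set.ncard_pos (toFinite _)).2 (hZ.image _)

theorem itinerary_ncard_add_le (hinv : MapsTo T Z Z) (m n : ℕ) :
    (itinerary T c (m + n) '' Z).ncard ≤
      (itinerary T c m '' Z).ncard * (itinerary T c n '' Z).ncard := by
  rw [← Set.ncard_prod]
  refine Set.ncard_le_ncard_of_injOn
    (fun u => (fun i => u (Fin.castAdd n i), fun i => u (Fin.natAdd m i))) ?_ ?_ (toFinite _)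
  · rintro _ ⟨x, hx, rfl⟩
    refine ⟨⟨x, hx, rfl⟩, ⟨T^[m] x, hinv.iterate m hx, ?_⟩⟩
    funext i
    simp only [itinerary, Fin.val_natAdd, ← Function.iterate_add_apply, add_comm]
  · intro u _ v _ huv
    simp only [Prod.mk.injEq] at huv
    funext i
    refine Fin.addCases (fun j => congrFun huv.1 j) (fun j => congrFun huv.2 j) i

theorem itinerary_ncard_mul_le {k m : ℕ} (hm : 0 < m) :
    (itinerary T c (k * m) '' Z).ncard ≤
      ((fun x => fun j : Fin k => itinerary T c m (T^[j * m] x)) '' Z).ncard := by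
  set ψ : (Fin k → Fin m → Fin q) → (Fin (k * m) → Fin q) :=
    fun v i => v ⟨i / m, (Nat.div_lt_iff_lt_mul hm).2 i.2⟩
      ⟨i % m, Nat.mod_lt _ hm⟩ with hψ
  have : itinerary T c (k * m) '' Z =
      ψ '' ((fun x => fun j : Fin k => itinerary T c m (T^[j * m] x)) '' Z) := by
    rw [image_image]
    refine image_congr fun x _ => ?_
    funext i
    simp only [hψ, itinerary, ← Function.iterate_add_apply]
    rw [add_comm, Nat.div_add_mod']
  rw [this]
  exact Set.ncard_image_le (toFinite _)

/-- If every two points with the same color are identified, the itineraries of length `m` of an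
invariant set contain cycles whose length grows subexponentially with `m`. -/
theorem exists_itinerary_cycle (hZ : Z.Nonempty) (hinv : MapsTo T Z Z) {ε : ℝ} (hε : 0 < ε) :
    ∀ᶠ m : ℕ in atTop, ∃ l : ℕ, 0 < l ∧ (l : ℝ) ≤ Real.exp (2 + ε * m) ∧ ∃ x : ℕ → X,
      (∀ j, x j ∈ Z) ∧ (∀ j, x (j + l) = x j) ∧
      ∀ j, itinerary T c m (T^[m] (x j)) = itinerary T c m (x (j + 1)) := by
  classical
  set p : ℕ → ℕ := fun m => (itinerary T c m '' Z).ncard with hp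
  have hp1 : ∀ m, (1 : ℝ) ≤ p m := fun m => by exact_mod_cast itinerary_ncard_pos hZ m
  have hp0 : ∀ m, (0 : ℝ) < p m := fun m => zero_lt_one.trans_le (hp1 m)
  have hsub : Subadditive fun m => Real.log (p m) := by
    intro m n
    rw [← Real.log_mul (hp0 m).ne' (hp0 n).ne']
    exact Real.log_le_log (hp0 _) (by exact_mod_cast itinerary_ncard_add_le hinv m n)
  have hbdd : BddBelow (range fun n : ℕ => Real.log (p n) / n) :=
    ⟨0, by rintro _ ⟨n, rfl⟩; exact div_nonneg (Real.log_nonneg (hp1 n)) n.cast_nonneg⟩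
  have hlim := hsub.tendsto_lim hbdd
  set h := hsub.lim
  filter_upwards [hlim.eventually_lt_const (show h < h + ε by linarith), eventually_gt_atTop 0]
    with m hm hm0
  have hmR : (0 : ℝ) < m := by exact_mod_cast hm0
  set k := ⌊Real.exp (1 + ε * m)⌋₊ + 1 with hk
  have hkgt : Real.exp (1 + ε * m) < k := by
    rw [hk]; push_cast; exact Nat.lt_floor_add_one _
  have hkle : (k : ℝ) ≤ Real.exp (2 + ε * m) := by
    have e1 : (k : ℝ) ≤ Real.exp (1 + ε * m) + 1 := by
      rw [hk]; push_cast
      linarith [Nat.floor_le (Real.exp_pos (1 + ε * m)).le]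
    have e2 : Real.exp (2 + ε * m) = Real.exp (1 + ε * m) * Real.exp 1 := by
      rw [← Real.exp_add]; ring_nf
    have e3 := Real.add_one_le_exp (1 : ℝ)
    have e4 := Real.one_le_exp (show 0 ≤ 1 + ε * m by positivity)
    nlinarith
  set R : (Fin m → Fin q) → (Fin m → Fin q) → Prop :=
    fun u v => ∃ x ∈ Z, itinerary T c m x = u ∧ itinerary T c m (T^[m] x) = v with hR
  have hcycle : ∃ l, 0 < l ∧ l ≤ k ∧ ∃ c : ℕ → (Fin m → Fin q),
      (∀ i < l, R (c i) (c (i + 1))) ∧ c l = c 0 := by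
    by_contra! hno
    have h1 := card_walks_le_choose R k hno (itinerary T c m '' Z).toFinite.toFinset
      ((fun x => fun j : Fin k => itinerary T c m (T^[j * m] x)) '' Z).toFinite.toFinset
      (by
        intro u hu i
        rw [Finite.mem_toFinset] at hu ⊢
        obtain ⟨x, hx, rfl⟩ := hu
        exact ⟨_, hinv.iterate _ hx, rfl⟩)
      (by
        intro u hu i j hij
        rw [Finite.mem_toFinset] at hu
        obtain ⟨x, hx, rfl⟩ := hu
        refine ⟨_, hinv.iterate (i * m) hx, rfl, ?_⟩
        simp only [← Function.iterate_add_apply]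
        rw [← hij, Nat.succ_mul, add_comm])
    rw [← Set.ncard_eq_toFinset_card, ← Set.ncard_eq_toFinset_card] at h1
    have h2 : (p (k * m) : ℝ) ≤ (p m : ℝ) ^ k / (k.factorial : ℝ) :=
      le_trans (by exact_mod_cast (itinerary_ncard_mul_le hm0).trans h1)
        (Nat.choose_le_pow_div k (p m))
    have hkm : k * m ≠ 0 := by positivity
    have h3 : Real.exp (h * (k * m)) ≤ p (k * m) := by
      have := hsub.lim_le_div hbdd hkm
      rw [le_div_iff₀ (by positivity)] at this
      rw [← Real.exp_log (hp0 (k * m))]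
      push_cast at this
      exact Real.exp_le_exp.2 this
    have h4 : (p m : ℝ) ≤ Real.exp ((h + ε) * m) := by
      rw [div_lt_iff₀ hmR] at hm
      rw [← Real.exp_log (hp0 m)]
      exact Real.exp_le_exp.2 hm.le
    have h5 : (p m : ℝ) ^ k ≤ Real.exp (k * ((h + ε) * m)) := by
      rw [Real.exp_nat_mul]
      exact pow_le_pow_left₀ (hp0 m).le h4 k
    have hfac : (0 : ℝ) < k.factorial := by exact_mod_cast Nat.factorial_pos k
    have h6 : (k.factorial : ℝ) ≤ Real.exp (k * (ε * m)) := by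
      have e1 : Real.exp (h * (k * m)) * k.factorial ≤ Real.exp (k * ((h + ε) * m)) := by
        have := h3.trans h2
        rw [le_div_iff₀ hfac] at this
        exact this.trans h5
      have e2 : Real.exp (k * ((h + ε) * m)) = Real.exp (h * (k * m)) * Real.exp (k * (ε * m)) := by
        rw [← Real.exp_add]; ring_nf
      rw [e2] at e1
      exact le_of_mul_le_mul_left e1 (Real.exp_pos _)
    have h7 := Real.pow_div_factorial_le_exp (k : ℝ) k.cast_nonneg k
    rw [div_le_iff₀ hfac] at h7
    have h8 : (k : ℝ) ^ k ≤ Real.exp (1 + ε * m) ^ k := by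
      rw [← Real.exp_nat_mul]
      calc (k : ℝ) ^ k ≤ Real.exp k * k.factorial := h7
        _ ≤ Real.exp k * Real.exp (k * (ε * m)) := by gcongr
        _ = _ := by rw [← Real.exp_add]; ring_nf
    have h9 := lt_of_pow_lt_pow_left₀ k (Real.exp_pos _).le
      (lt_of_le_of_ne h8 fun he => by
        have := pow_lt_pow_left₀ hkgt (Real.exp_pos _).le (show k ≠ 0 by omega)
        linarith)
    linarith
  obtain ⟨l, hl0, hlk, w, hw, hwl⟩ := hcycle
  have hx : ∀ i, ∃ x ∈ Z, i < l → itinerary T c m x = w i ∧ itinerary T c m (T^[m] x) = w (i + 1) := by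
    intro i
    by_cases hi : i < l
    · obtain ⟨x, hx, h1, h2⟩ := hw i hi
      exact ⟨x, hx, fun _ => ⟨h1, h2⟩⟩
    · obtain ⟨x, hx⟩ := hZ
      exact ⟨x, hx, fun h => absurd h hi⟩
  choose x hxZ hx using hx
  refine ⟨l, hl0, le_trans (by exact_mod_cast hlk) hkle, fun j => x (j % l), fun j => hxZ _,
    fun j => by simp, fun j => ?_⟩
  rw [(hx (j % l) (Nat.mod_lt _ hl0)).2, (hx ((j + 1) % l) (Nat.mod_lt _ hl0)).1]
  rcases Nat.lt_or_ge (j % l + 1) l with h1 | h1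
  · rw [Nat.add_mod j 1 l, Nat.mod_eq_of_lt (show 1 < l by omega), Nat.mod_eq_of_lt h1]
  · have h2 : j % l + 1 = l := by have := Nat.mod_lt j hl0; omega
    have h3 : (j + 1) % l = 0 := by
      rw [← Nat.mod_add_mod, h2, Nat.mod_self]
    rw [h3, h2, hwl]

end Itinerary

namespace IsOpenExpanding

variable {X : Type*} [MetricSpace X] {T : X → X} {lam η : ℝ}

theorem dist_le_of_itinerary_eq (hT : IsOpenExpanding T lam η) {q : ℕ} {c : X → Fin q}
    (hcol : ∀ x y, c x = c y → dist x y ≤ η) {m : ℕ} {x y : X}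
    (h : itinerary T c (m + 1) x = itinerary T c (m + 1) y) : dist x y ≤ η / lam ^ m := by
  have h1 := hT.one_lt
  have hd : ∀ i ≤ m, dist (T^[i] x) (T^[i] y) ≤ η := fun i hi =>
    hcol _ _ (congrFun h ⟨i, by omega⟩)
  have key : ∀ i ≤ m, lam ^ i * dist x y ≤ dist (T^[i] x) (T^[i] y) := by
    intro i
    induction i with
    | zero => simp
    | succ i ih =>
      intro hi
      rw [Function.iterate_succ_apply', Function.iterate_succ_apply']
      have h2 := hT.expand _ _ (hd i (by omega))
      have h3 := mul_le_mul_of_nonneg_left (ih (by omega)) (show 0 ≤ lam by linarith)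
      calc lam ^ (i + 1) * dist x y = lam * (lam ^ i * dist x y) := by ring
        _ ≤ _ := h3.trans h2
  rw [le_div_iff₀ (by positivity), mul_comm]
  exact (key m le_rfl).trans (hd m le_rfl)

/-- Periodic orbits approximate an invariant set superpolynomially fast in the period. -/
theorem exists_periodic_approx [CompactSpace X] (hT : IsOpenExpanding T lam η) (hc : Continuous T)
    {Z : Set X} (hZ : Z.Nonempty) (hinv : MapsTo T Z Z) (b : ℕ) {τ : ℝ} (hτ : 0 < τ) :
    ∃ n z, 0 < n ∧ T^[n] z = z ∧
      (n : ℝ) ^ b * ∑ i ∈ Finset.range n, Metric.infDist (T^[i] z) Z ≤ τ := by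
  have h1 := hT.one_lt
  have hη := hT.pos
  have h10 : 0 < lam - 1 := by linarith
  obtain ⟨q, c, hcol⟩ := exists_fin_coloring X hη
  have hlog : 0 < Real.log lam := Real.log_pos h1
  set ε := Real.log lam / (2 * (b + 1)) with hε
  have hε0 : 0 < ε := by positivity
  set κ := Real.exp (-(Real.log lam / 2)) with hκ
  have hκ1 : κ < 1 := Real.exp_lt_one_iff.2 (by linarith)
  have hκ0 : 0 < κ := Real.exp_pos _
  set D := Real.exp (2 * (b + 1)) * (η * lam) / (lam - 1) with hD
  have hlim : Tendsto (fun m : ℕ => D * ((m : ℝ) ^ b * κ ^ m)) atTop (nhds 0) := by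
    have := (tendsto_pow_const_mul_const_pow_of_abs_lt_one b
      (show |κ| < 1 by rwa [abs_of_pos hκ0])).const_mul D
    rwa [mul_zero] at this
  have hlim2 : Tendsto (fun m : ℕ => η * lam * (lam⁻¹) ^ m) atTop (nhds 0) := by
    have := (tendsto_pow_atTop_nhds_zero_of_lt_one (show 0 ≤ lam⁻¹ by positivity)
      (inv_lt_one_of_one_lt₀ h1)).const_mul (η * lam)
    rwa [mul_zero] at this
  obtain ⟨m, hm1, hm2, hm3, hm0⟩ := ((exists_itinerary_cycle (T := T) (c := c) hZ hinv hε0).and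
    ((hlim.eventually_le_const hτ).and ((hlim2.eventually_le_const hT.threshold_pos).and
      (eventually_gt_atTop 0)))).exists
  obtain ⟨l, hl0, hl, x, hxZ, hxl, hx⟩ := hm1
  obtain ⟨m, rfl⟩ : ∃ m', m = m' + 1 := ⟨m - 1, by omega⟩
  have he : η / lam ^ m = η * lam * lam⁻¹ ^ (m + 1) := by
    rw [inv_pow, pow_succ]; field_simp
  obtain ⟨z, hz, hsum⟩ := hT.closing_blocks hc hm0 hxl
    (fun j => hT.dist_le_of_itinerary_eq hcol (hx j)) (by rw [he]; exact hm3)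
  refine ⟨l * (m + 1), z, by positivity, hz, ?_⟩
  set M := m + 1 with hM
  have hs1 : ∑ i ∈ Finset.range (l * M), Metric.infDist (T^[i] z) Z ≤
      l * (η / lam ^ m) / (lam - 1) := by
    rw [le_div_iff₀ h10, mul_comm]
    refine le_trans ?_ hsum
    gcongr with i hi
    exact Metric.infDist_le_dist_of_mem (hinv.iterate _ (hxZ _))
  have hκM : κ ^ M = Real.exp (ε * M) ^ (b + 1) * lam⁻¹ ^ M := by
    have e1 : lam⁻¹ = Real.exp (-Real.log lam) := by rw [Real.exp_neg, Real.exp_log (by linarith)]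
    rw [e1, hκ, ← Real.exp_nat_mul, ← Real.exp_nat_mul, ← Real.exp_nat_mul, ← Real.exp_add, hε]
    congr 1
    push_cast
    field_simp
    ring
  calc ((l * M : ℕ) : ℝ) ^ b * ∑ i ∈ Finset.range (l * M), Metric.infDist (T^[i] z) Z
      ≤ ((l * M : ℕ) : ℝ) ^ b * (l * (η / lam ^ m) / (lam - 1)) := by gcongr
    _ = (l : ℝ) ^ (b + 1) * ((M : ℝ) ^ b * (η * lam * lam⁻¹ ^ M) / (lam - 1)) := by
        rw [he]; push_cast; ring
    _ ≤ Real.exp (2 + ε * M) ^ (b + 1) * ((M : ℝ) ^ b * (η * lam * lam⁻¹ ^ M) / (lam - 1)) := by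
        gcongr
    _ = D * ((M : ℝ) ^ b * κ ^ M) := by
        rw [hκM, hD, Real.exp_add, mul_pow, ← Real.exp_nat_mul 2]
        push_cast
        rw [mul_comm (2 : ℝ) (b + 1)]
        ring
    _ ≤ τ := hm2

end IsOpenExpanding

theorem birkhoffSum_iterate_of_iterate_eq {X : Type*} {T : X → X} {n : ℕ} {x : X}
    (hx : T^[n] x = x) (g : X → ℝ) (k : ℕ) :
    birkhoffSum T g n (T^[k] x) = birkhoffSum T g n x := by
  induction k with
  | zero => rfl
  | succ k ih =>
    rw [Function.iterate_succ_apply', ← ih, ← sub_eq_zero, birkhoffSum_apply_sub_birkhoffSum,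
      ← Function.iterate_add_apply, add_comm, Function.iterate_add_apply, hx, sub_self]

theorem birkhoffSum_le_mul {X : Type*} {T : X → X} {g : X → ℝ} {N : ℕ} {a : ℝ}
    (h : ∀ x, birkhoffSum T g N x ≤ a) (k : ℕ) (x : X) :
    birkhoffSum T g (k * N) x ≤ k * a := by
  induction k with
  | zero => simp
  | succ k ih =>
    rw [Nat.succ_mul, birkhoffSum_add]
    push_cast
    linarith [h (T^[k * N] x)]

/-- The set where every Birkhoff sum of a nonpositive function with zero maximal periodic average
vanishes. -/
theorem exists_invariant_zero_set {X : Type*} [TopologicalSpace X] [CompactSpace X] [Nonempty X]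
    {T : X → X} (hc : Continuous T) {F : X → ℝ} (hF : Continuous F) (hF0 : ∀ x, F x ≤ 0)
    (hsup : ∀ δ > 0, ∃ n z, 0 < n ∧ T^[n] z = z ∧ -(n * δ) < birkhoffSum T F n z) :
    ∃ Z : Set X, Z.Nonempty ∧ MapsTo T Z Z ∧ ∀ x ∈ Z, F x = 0 := by
  have hcont : ∀ N, Continuous (birkhoffSum T F N) := fun N =>
    continuous_finsetSum _ fun i _ => hF.comp (hc.iterate i)
  have hle : ∀ N x, birkhoffSum T F N x ≤ 0 := fun N x => Finset.sum_nonpos fun i _ => hF0 _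
  have hcl : ∀ N, IsClosed {x | birkhoffSum T F N x = 0} := fun N =>
    isClosed_eq (hcont N) continuous_const
  have hne : ∀ N, {x | birkhoffSum T F N x = 0}.Nonempty := by
    intro N
    by_contra hempty
    obtain ⟨x₀, -, hx₀⟩ := isCompact_univ.exists_isMaxOn univ_nonempty (hcont N).continuousOn
    have hlt : birkhoffSum T F N x₀ < 0 :=
      lt_of_le_of_ne (hle _ _) fun h => hempty ⟨x₀, h⟩
    have hN : 0 < N := by
      rcases Nat.eq_zero_or_pos N with rfl | h
      · simp at hlt
      · exact h
    have hNR : (0 : ℝ) < N := by exact_mod_cast hN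
    obtain ⟨n, z, hn, hz, hlow⟩ := hsup (-birkhoffSum T F N x₀ / N) (div_pos (by linarith) hNR)
    have h1 := birkhoffSum_mul_of_iterate_eq hz F N
    have h2 := birkhoffSum_le_mul (fun x => hx₀ (mem_univ x)) n z
    rw [mul_comm n N, h1] at h2
    have h3 := mul_lt_mul_of_pos_left hlow hNR
    have h4 : (N : ℝ) * -(n * (-birkhoffSum T F N x₀ / N)) = n * birkhoffSum T F N x₀ := by
      field_simp
    linarith
  refine ⟨⋂ N, {x | birkhoffSum T F N x = 0}, ?_, ?_, ?_⟩
  · refine IsCompact.nonempty_iInter_of_sequence_nonempty_isCompact_isClosed _ (fun N x hx => ?_)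
      hne (hcl 0).isCompact hcl
    have h1 : birkhoffSum T F (N + 1) x = 0 := hx
    rw [birkhoffSum_succ] at h1
    have := hle N x
    have := hF0 (T^[N] x)
    show birkhoffSum T F N x = 0
    linarith
  · intro x hx
    rw [mem_iInter] at hx ⊢
    intro N
    have h1 : birkhoffSum T F 1 x = 0 := hx 1
    have h2 : birkhoffSum T F (N + 1) x = 0 := hx (N + 1)
    rw [birkhoffSum_one] at h1
    rw [birkhoffSum_succ', h1, zero_add] at h2
    exact h2
  · intro x hx
    have h1 : birkhoffSum T F 1 x = 0 := mem_iInter.1 hx 1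
    rwa [birkhoffSum_one] at h1

namespace IsOpenExpanding

variable {X : Type*} [MetricSpace X] {T : X → X} {lam η : ℝ}

theorem threshold_le (hT : IsOpenExpanding T lam η) : (lam - 1) * η / 2 ≤ η := by
  nlinarith [hT.le_two, hT.pos]

theorem exists_gap_of_le (hT : IsOpenExpanding T lam η) {n : ℕ} {z : X} (hn : 0 < n)
    (hz : T^[n] z = z) {s τ : ℝ} (hτ : 0 < τ) (hs : s ≤ τ * η)
    (hgap : ∀ i j, T^[i] z ≠ T^[j] z → s ≤ τ * dist (T^[i] z) (T^[j] z)) :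
    ∃ γ, 0 < γ ∧ γ ≤ η ∧ s ≤ τ * γ ∧
      ∀ i j, T^[i] z ≠ T^[j] z → γ ≤ dist (T^[i] z) (T^[j] z) := by
  have hev : ∀ᶠ γ in nhdsWithin (0 : ℝ) (Ioi 0), ∀ p ∈ Finset.range n ×ˢ Finset.range n,
      T^[p.1] z ≠ T^[p.2] z → γ ≤ dist (T^[p.1] z) (T^[p.2] z) := by
    rw [Filter.eventually_all_finset]
    intro p _
    by_cases hp : T^[p.1] z = T^[p.2] z
    · simp [hp]
    · have := (eventually_le_nhds (dist_pos.2 hp)).filter_mono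
        (nhdsWithin_le_nhds (s := Ioi (0 : ℝ)))
      filter_upwards [this] with γ h _ using h
  have hev2 := (eventually_le_nhds hT.pos).filter_mono (nhdsWithin_le_nhds (s := Ioi (0 : ℝ)))
  obtain ⟨γ, hγ, hγη, hγ0⟩ := (hev.and (hev2.and self_mem_nhdsWithin)).exists
  refine ⟨max γ (s / τ), lt_max_of_lt_left hγ0, max_le hγη ?_, ?_, fun i j hij => max_le ?_ ?_⟩
  · rwa [div_le_iff₀ hτ, mul_comm]
  · rw [← div_le_iff₀' hτ]
    exact le_max_right _ _
  · have hp : Function.IsPeriodicPt T n z := hz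
    have h1 := hγ (i % n, j % n) (by simp [Nat.mod_lt _ hn])
    simp only [hp.iterate_mod_apply] at h1
    exact h1 hij
  · rw [div_le_iff₀' hτ]
    exact hgap i j hij

theorem exists_gap_orbit_of_pow [CompactSpace X] (hT : IsOpenExpanding T lam η)
    (hc : Continuous T) {Z : Set X} {τ : ℝ} (hτ : 0 < τ) (k : ℕ) :
    ∀ n z, 0 < n → n ≤ 2 ^ k → T^[n] z = z →
      (1 + 1 / (τ * (lam - 1))) ^ k * birkhoffSum T (fun x => Metric.infDist x Z) n z ≤
        τ * ((lam - 1) * η / 2) →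
      ∃ n z γ, 0 < n ∧ T^[n] z = z ∧ 0 < γ ∧ γ ≤ η ∧
        birkhoffSum T (fun x => Metric.infDist x Z) n z ≤ τ * γ ∧
        ∀ i j, T^[i] z ≠ T^[j] z → γ ≤ dist (T^[i] z) (T^[j] z) := by
  have h1 : 0 < lam - 1 := by linarith [hT.one_lt]
  set D := 1 + 1 / (τ * (lam - 1)) with hD
  have hD1 : 1 ≤ D := by
    have : 0 < 1 / (τ * (lam - 1)) := by positivity
    linarith
  set f : X → ℝ := fun x => Metric.infDist x Z with hf
  have hf0 : ∀ n x, 0 ≤ birkhoffSum T f n x := fun n x =>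
    Finset.sum_nonneg fun i _ => Metric.infDist_nonneg
  have hflip : ∀ x y, |f x - f y| ≤ 1 * dist x y := fun x y => by
    have := (Metric.lipschitz_infDist_pt Z).dist_le_mul x y
    rwa [Real.dist_eq] at this
  induction k with
  | zero =>
    intro n z hn hnk hz hs
    obtain rfl : n = 1 := by simp at hnk; omega
    rw [pow_zero, one_mul] at hs
    obtain ⟨γ, hγ⟩ := hT.exists_gap_of_le hn hz hτ
      (hs.trans (mul_le_mul_of_nonneg_left hT.threshold_le hτ.le)) (fun i j hij => by
        refine absurd ?_ hij
        have hz' : T z = z := hz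
        rw [Function.iterate_fixed hz', Function.iterate_fixed hz'])
    exact ⟨1, z, γ, hn, hz, hγ⟩
  | succ k ih =>
    intro n z hn hnk hz hs
    set s := birkhoffSum T f n z with hsdef
    have hs0 : 0 ≤ s := hf0 n z
    have hs' : s ≤ τ * ((lam - 1) * η / 2) :=
      (le_mul_of_one_le_left hs0 (one_le_pow₀ hD1)).trans hs
    by_cases hgap : ∀ i j, T^[i] z ≠ T^[j] z → s ≤ τ * dist (T^[i] z) (T^[j] z)
    · obtain ⟨γ, hγ⟩ := hT.exists_gap_of_le hn hz hτ
        (hs'.trans (mul_le_mul_of_nonneg_left hT.threshold_le hτ.le)) hgap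
      exact ⟨n, z, γ, hn, hz, hγ⟩
    have hsplit : ∀ i l, 0 < l → 2 * l ≤ n →
        τ * dist (T^[l] (T^[i] z)) (T^[i] z) ≤ s → ∃ n z γ, 0 < n ∧ T^[n] z = z ∧ 0 < γ ∧ γ ≤ η ∧
        birkhoffSum T f n z ≤ τ * γ ∧
        ∀ i j, T^[i] z ≠ T^[j] z → γ ≤ dist (T^[i] z) (T^[j] z) := by
      intro i l hl hln hd
      set y := T^[i] z with hy
      obtain ⟨z', hz', hsum⟩ := hT.closing_return hc hl
        (le_of_mul_le_mul_left (hd.trans hs') hτ)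
      refine ih l z' hl (by rw [pow_succ] at hnk; omega) hz' (le_trans ?_ hs)
      have e1 := le_of_abs_le (abs_birkhoffSum_sub_le (T := T) hflip l z' y)
      have e2 : birkhoffSum T f l y ≤ s := by
        rw [hsdef, ← birkhoffSum_iterate_of_iterate_eq hz f i]
        exact Finset.sum_le_sum_of_subset_of_nonneg (Finset.range_mono (by omega))
          fun _ _ _ => Metric.infDist_nonneg
      have e3 : ∑ i ∈ Finset.range l, dist (T^[i] z') (T^[i] y) ≤ s * (1 / (τ * (lam - 1))) := by
        rw [mul_one_div, le_div_iff₀ (by positivity)]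
        calc _ = τ * ((lam - 1) * ∑ i ∈ Finset.range l, dist (T^[i] z') (T^[i] y)) := by ring
          _ ≤ τ * dist (T^[l] y) y := by gcongr
          _ ≤ s := hd
      have e4 : birkhoffSum T f l z' ≤ D * s := by
        rw [hD, add_mul, one_mul, mul_comm _ s]
        linarith
      calc D ^ k * birkhoffSum T f l z' ≤ D ^ k * (D * s) := by gcongr
        _ = D ^ (k + 1) * s := by ring
    push Not at hgap
    obtain ⟨i, j, hij, hd⟩ := hgap
    have hp : Function.IsPeriodicPt T n z := hz
    rw [← hp.iterate_mod_apply i, ← hp.iterate_mod_apply j] at hij hd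
    have hi := Nat.mod_lt i hn
    have hj := Nat.mod_lt j hn
    generalize i % n = i at *
    generalize j % n = j at *
    wlog hlt : i < j generalizing i j
    · refine this j hj i hi hij.symm (by rwa [dist_comm]) (lt_of_le_of_ne (not_lt.1 hlt) ?_)
      rintro rfl
      exact hij rfl
    rcases Nat.lt_or_ge n (2 * (j - i)) with h | h
    · refine hsplit j (n - (j - i)) (by omega) (by omega) ?_
      rw [← Function.iterate_add_apply, show n - (j - i) + j = i + n by omega,
        Function.iterate_add_apply, hz]
      exact hd.le
    · refine hsplit i (j - i) (by omega) h ?_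
      rw [← Function.iterate_add_apply, show j - i + i = j by omega, dist_comm]
      exact hd.le

/-- Every invariant set is approximated by a periodic orbit whose gap is large compared with the
total distance of the orbit to the set. -/
theorem exists_gap_orbit [CompactSpace X] (hT : IsOpenExpanding T lam η) (hc : Continuous T)
    {Z : Set X} (hZ : Z.Nonempty) (hinv : MapsTo T Z Z) {τ : ℝ} (hτ : 0 < τ) :
    ∃ n z γ, 0 < n ∧ T^[n] z = z ∧ 0 < γ ∧ γ ≤ η ∧
      birkhoffSum T (fun x => Metric.infDist x Z) n z ≤ τ * γ ∧
      ∀ i j, T^[i] z ≠ T^[j] z → γ ≤ dist (T^[i] z) (T^[j] z) := by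
  have h1 : 0 < lam - 1 := by linarith [hT.one_lt]
  set D := 1 + 1 / (τ * (lam - 1)) with hD
  have hD0 : 0 ≤ D := by positivity
  obtain ⟨b, hb⟩ := pow_unbounded_of_one_lt D (one_lt_two (α := ℝ))
  have hthr := hT.threshold_pos
  obtain ⟨n, z, hn, hz, hs⟩ := hT.exists_periodic_approx hc hZ hinv b
    (show 0 < τ * ((lam - 1) * η / 2) / 2 ^ b by positivity)
  refine hT.exists_gap_orbit_of_pow hc hτ (Nat.log 2 n + 1) n z hn
    (Nat.lt_pow_succ_log_self one_lt_two n).le hz ?_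
  have h2 : (2 : ℝ) ^ (Nat.log 2 n + 1) ≤ 2 * n := by
    rw [pow_succ, mul_comm]
    gcongr
    exact_mod_cast Nat.pow_log_le_self 2 hn.ne'
  have h3 : D ^ (Nat.log 2 n + 1) ≤ 2 ^ b * (n : ℝ) ^ b :=
    calc D ^ (Nat.log 2 n + 1) ≤ (2 ^ b) ^ (Nat.log 2 n + 1) := by gcongr
      _ = (2 ^ (Nat.log 2 n + 1)) ^ b := by rw [← pow_mul, ← pow_mul, mul_comm]
      _ ≤ (2 * n) ^ b := by gcongr
      _ = 2 ^ b * (n : ℝ) ^ b := mul_pow _ _ _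
  have h4 : 0 ≤ birkhoffSum T (fun x => Metric.infDist x Z) n z :=
    Finset.sum_nonneg fun i _ => Metric.infDist_nonneg
  have h5 := mul_le_mul_of_nonneg_right h3 h4
  rw [le_div_iff₀ (by positivity)] at hs
  refine h5.trans (le_trans (le_of_eq ?_) hs)
  rw [birkhoffSum]
  ring

theorem exists_max_periodic_average [CompactSpace X] [Nonempty X] (hT : IsOpenExpanding T lam η)
    (hc : Continuous T) {φ : X → ℝ} (hφ : Continuous φ) :
    ∃ Q, (∀ n x, 0 < n → T^[n] x = x → birkhoffSum T φ n x ≤ n * Q) ∧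
      ∀ δ > 0, ∃ n x, 0 < n ∧ T^[n] x = x ∧ n * (Q - δ) < birkhoffSum T φ n x := by
  obtain ⟨M, hM⟩ := (isCompact_univ.image hφ).bddAbove
  set S : Set ℝ := {s | ∃ n x, 0 < n ∧ T^[n] x = x ∧ s = birkhoffSum T φ n x / n} with hS
  obtain ⟨n₀, z₀, hn₀, hz₀⟩ := hT.exists_periodic hc
  have hbdd : BddAbove S := by
    refine ⟨M, ?_⟩
    rintro _ ⟨n, x, hn, -, rfl⟩
    rw [div_le_iff₀ (by exact_mod_cast hn), mul_comm, ← birkhoffSum_const_real T M n x]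
    exact Finset.sum_le_sum fun i _ => hM ⟨_, mem_univ _, rfl⟩
  refine ⟨sSup S, fun n x hn hx => ?_, fun δ hδ => ?_⟩
  · rw [← div_le_iff₀' (by exact_mod_cast hn)]
    exact le_csSup hbdd ⟨n, x, hn, hx, rfl⟩
  · obtain ⟨_, ⟨n, x, hn, hx, rfl⟩, h⟩ := exists_lt_of_lt_csSup
      (s := S) ⟨_, n₀, z₀, hn₀, hz₀, rfl⟩ (show sSup S - δ < sSup S by linarith)
    rw [lt_div_iff₀' (by exact_mod_cast hn)] at h
    exact ⟨n, x, hn, hx, h⟩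

end IsOpenExpanding

namespace IsOpenExpanding

variable {X : Type*} [MetricSpace X] {T : X → X} {lam η : ℝ}

/-- A function that is very negative away from a well-separated orbit, nonpositive except close to
it, and whose sums along pieces shadowing the orbit are bounded, has bounded Birkhoff sums. -/
theorem birkhoffSum_le_of_shadowing (hT : IsOpenExpanding T lam η) {L : ℝ} (hL0 : 0 ≤ L)
    (hL : ∀ x y, dist (T x) (T y) ≤ L * dist x y) {z : X} {γ ρ ρ' κ : ℝ} (hγη : γ ≤ η)
    (hgap : ∀ i j, T^[i] z ≠ T^[j] z → γ ≤ dist (T^[i] z) (T^[j] z))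
    (hρ' : 0 < ρ') (hρρ' : ρ' ≤ ρ) (hργ : (L + 2) * ρ ≤ γ) (hκ : 0 ≤ κ) {H : X → ℝ}
    (hmid : ∀ x, (∀ i, ρ' ≤ dist x (T^[i] z)) → H x ≤ 0)
    (hfar : ∀ x, (∀ i, ρ ≤ dist x (T^[i] z)) → H x ≤ -κ)
    (hnear : ∀ m x i, (∀ t < m, dist (T^[t] x) (T^[i + t] z) < ρ') → birkhoffSum T H m x ≤ κ) :
    ∀ N x, birkhoffSum T H N x ≤ κ := by
  have h1 := hT.one_lt
  have hρ : 0 < ρ := hρ'.trans_le hρρ'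
  have hLρ : 0 ≤ L * ρ := by positivity
  have hsep : ∀ x i j, dist x (T^[i] z) ≤ L * ρ + ρ → dist x (T^[i] z) ≤ dist x (T^[j] z) ∨
      ρ ≤ dist x (T^[j] z) := by
    intro x i j hx
    by_cases hij : T^[i] z = T^[j] z
    · rw [hij]
      exact Or.inl le_rfl
    · right
      have := hgap i j hij
      have := dist_triangle_left (T^[i] z) (T^[j] z) x
      linarith
  have hstep : ∀ x i t, dist (T^[t] x) (T^[i + t] z) < ρ →
      lam * dist (T^[t] x) (T^[i + t] z) ≤ dist (T^[t + 1] x) (T^[i + (t + 1)] z) := by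
    intro x i t h
    rw [← add_assoc, Function.iterate_succ_apply', Function.iterate_succ_apply']
    exact hT.expand _ _ (by linarith)
  have hshadow : ∀ m x i, (∀ t < m, dist (T^[t] x) (T^[i + t] z) < ρ) →
      birkhoffSum T H m x ≤ κ := by
    intro m
    induction m with
    | zero => intro x i _; simpa using hκ
    | succ m ih =>
      intro x i h
      rcases lt_or_ge (dist (T^[m] x) (T^[i + m] z)) ρ' with hm | hm
      · refine hnear _ x i fun t ht => ?_
        have hmono : ∀ t ≤ m, dist (T^[m - t] x) (T^[i + (m - t)] z) < ρ' := by
          intro t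
          induction t with
          | zero => intro _; exact hm
          | succ t iht =>
            intro ht
            have h2 := hstep x i (m - (t + 1)) (h _ (by omega))
            rw [show m - (t + 1) + 1 = m - t by omega] at h2
            have h3 := iht (by omega)
            have h4 : 0 ≤ dist (T^[m - (t + 1)] x) (T^[i + (m - (t + 1))] z) := dist_nonneg
            nlinarith
        have := hmono (m - t) (by omega)
        rwa [show m - (m - t) = t by omega] at this
      · rw [birkhoffSum_succ]
        have h2 := ih x i fun t ht => h t (by omega)
        have h3 : H (T^[m] x) ≤ 0 := hmid _ fun j => by
          have := h m (by omega)
          rcases hsep (T^[m] x) (i + m) j (by linarith) with h | h <;> linarith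
        linarith
  intro N
  induction N using Nat.strong_induction_on with
  | _ N ih =>
    intro x
    rcases Nat.eq_zero_or_pos N with rfl | hN
    · simpa using hκ
    by_cases hx : ∃ i, dist x (T^[i] z) < ρ
    · obtain ⟨i, hi⟩ := hx
      by_cases hex : ∃ t, t < N ∧ ρ ≤ dist (T^[t] x) (T^[i + t] z)
      · classical
        obtain ⟨hjN, hj⟩ := Nat.find_spec hex
        have hmin : ∀ t < Nat.find hex, dist (T^[t] x) (T^[i + t] z) < ρ := fun t ht => by
          by_contra hcon
          exact Nat.find_min hex ht ⟨ht.trans hjN, not_lt.1 hcon⟩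
        generalize Nat.find hex = j at *
        obtain _ | j := j
        · exact absurd hi (not_lt.2 hj)
        have h2 := hmin j (by omega)
        have h3 : dist (T^[j + 1] x) (T^[i + (j + 1)] z) ≤ L * ρ := by
          rw [← add_assoc, Function.iterate_succ_apply', Function.iterate_succ_apply']
          exact (hL _ _).trans (by gcongr)
        have h4 : H (T^[j + 1] x) ≤ -κ := hfar _ fun k => by
          rcases hsep (T^[j + 1] x) (i + (j + 1)) k (by linarith) with h | h <;> linarith
        have h5 := hshadow (j + 1) x i hmin
        obtain ⟨k, rfl⟩ : ∃ k, N = j + 1 + (k + 1) := ⟨N - (j + 1) - 1, by omega⟩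
        have h6 := ih k (by omega) (T (T^[j + 1] x))
        rw [birkhoffSum_add, birkhoffSum_succ' T H k]
        linarith
      · push Not at hex
        exact hshadow N x i hex
    · push Not at hx
      obtain ⟨N, rfl⟩ : ∃ k, N = k + 1 := ⟨N - 1, by omega⟩
      rw [birkhoffSum_succ']
      have := hfar x hx
      have := ih N (by omega) (T x)
      linarith

theorem sum_dist_le_of_forall_lt (hT : IsOpenExpanding T lam η) {x y : X} {m : ℕ} {ρ : ℝ}
    (hρ0 : 0 ≤ ρ) (hρ : ρ ≤ η) (h : ∀ t < m, dist (T^[t] x) (T^[t] y) < ρ) :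
    (lam - 1) * ∑ t ∈ Finset.range m, dist (T^[t] x) (T^[t] y) ≤ 2 * ρ := by
  have h1 := hT.one_lt
  have h2 := hT.le_two
  obtain _ | m := m
  · simpa using hρ0
  have key : ∀ k ≤ m, (lam - 1) * ∑ t ∈ Finset.range k, dist (T^[t] x) (T^[t] y) ≤
      dist (T^[k] x) (T^[k] y) := by
    intro k
    induction k with
    | zero => simp
    | succ k ih =>
      intro hk
      have h3 := hT.expand _ _ ((h k (by omega)).le.trans hρ)
      rw [Finset.sum_range_succ, Function.iterate_succ_apply', Function.iterate_succ_apply']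
      linarith [ih (by omega)]
  have h3 := key m le_rfl
  have h4 := h m (by omega)
  have h5 : 0 ≤ dist (T^[m] x) (T^[m] y) := dist_nonneg
  rw [Finset.sum_range_succ]
  nlinarith

theorem birkhoffSum_le_of_separated (hT : IsOpenExpanding T lam η) {L : ℝ} (hL0 : 0 ≤ L)
    (hL : ∀ x y, dist (T x) (T y) ≤ L * dist x y) {n : ℕ} {z : X} (hn : 0 < n) (hz : T^[n] z = z)
    {γ ρ ρ' ε δ C : ℝ} (hγη : γ ≤ η)
    (hgap : ∀ i j, T^[i] z ≠ T^[j] z → γ ≤ dist (T^[i] z) (T^[j] z))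
    (hρ' : 0 < ρ') (hρρ' : ρ' ≤ ρ / 4) (hργ : (L + 2) * ρ ≤ γ) (hε : 0 < ε) (hC : 0 ≤ C)
    {F q e : X → ℝ} (hF0 : ∀ x, F x ≤ 0) (hF : ∀ x y, |F x - F y| ≤ C * dist x y)
    (hFz : -birkhoffSum T F n z ≤ ε * ρ' / 4) (hδ0 : 0 ≤ δ) (hδ : δ ≤ ε * ρ' / (16 * n))
    (hCδ : (C + δ) * (2 * ρ' / (lam - 1)) ≤ ε * ρ / 8)
    (hq0 : ∀ x, 0 ≤ q x) (hq : ∀ x, ∃ i, dist x (T^[i] z) ≤ q x)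
    (he : ∀ x, |e x| ≤ δ) (hel : ∀ x y, |e x - e y| ≤ δ * dist x y) :
    ∀ N x, n * birkhoffSum T (fun x => F x - ε * q x + e x) N x ≤
      n * (ε * ρ / 2) + N * birkhoffSum T (fun x => F x + e x) n z := by
  have h1 := hT.one_lt
  have h2 := hT.le_two
  have h1' : 0 < lam - 1 := by linarith
  have hnR : (1 : ℝ) ≤ n := by exact_mod_cast hn
  have hn0 : (n : ℝ) ≠ 0 := by positivity
  set A := birkhoffSum T (fun x => F x + e x) n z / n with hA
  have hnA : birkhoffSum T (fun x => F x + e x) n z = n * A := by rw [hA]; field_simp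
  have hnδ : n * δ ≤ ε * ρ' / 16 := by
    rw [le_div_iff₀ (by positivity)] at hδ
    linarith
  have hδ1 : δ ≤ ε * ρ' / 16 := by nlinarith
  have hAlow : -(n * A) ≤ n * δ + ε * ρ' / 4 := by
    have h3 : -(n * δ) ≤ birkhoffSum T e n z := by
      rw [← mul_neg, ← birkhoffSum_const_real T (-δ) n z]
      exact Finset.sum_le_sum fun i _ => neg_le_of_abs_le (he _)
    have h4 : birkhoffSum T (fun x => F x + e x) n z = birkhoffSum T F n z + birkhoffSum T e n z :=
      Finset.sum_add_distrib
    linarith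
  have hA1 : -A ≤ δ + ε * ρ' / 4 := by
    have h3 : 0 ≤ ε * ρ' / 4 := by positivity
    have h4 : n * -A ≤ n * (δ + ε * ρ' / 4) := by nlinarith
    exact le_of_mul_le_mul_left h4 (by positivity)
  have hερ : ε * ρ' ≤ ε * ρ / 4 := by nlinarith
  have hερ0 : 0 < ε * ρ' := by positivity
  have hρ : 0 < ρ := by linarith
  have hρη : ρ ≤ η := by nlinarith
  have key := hT.birkhoffSum_le_of_shadowing hL0 hL hγη hgap (κ := ε * ρ / 2) hρ'
    (by linarith) hργ (by positivity) (H := fun x => F x - ε * q x + e x - A) ?_ ?_ ?_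
  · intro N x
    have h3 := key N x
    have h4 : birkhoffSum T (fun x => F x - ε * q x + e x - A) N x =
        birkhoffSum T (fun x => F x - ε * q x + e x) N x - N * A := by
      rw [← birkhoffSum_const_real T A N x]
      exact Finset.sum_sub_distrib _ _
    rw [h4] at h3
    rw [hnA]
    nlinarith
  · intro x hx
    obtain ⟨i, hi⟩ := hq x
    have h3 := hx i
    have h4 := hF0 x
    have h5 := le_of_abs_le (he x)
    have h6 : ε * ρ' ≤ ε * q x := by gcongr; linarith
    linarith
  · intro x hx
    obtain ⟨i, hi⟩ := hq x
    have h3 := hx i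
    have h4 := hF0 x
    have h5 := le_of_abs_le (he x)
    have h6 : ε * ρ ≤ ε * q x := by gcongr; linarith
    linarith
  · intro m x i h
    set k : X → ℝ := fun x => F x + e x - A with hk
    have hklip : ∀ x y, |k x - k y| ≤ (C + δ) * dist x y := fun x y => by
      have h3 : k x - k y = (F x - F y) + (e x - e y) := by simp only [hk]; ring
      rw [h3, add_mul]
      exact (abs_add_le _ _).trans (add_le_add (hF x y) (hel x y))
    have hkz : birkhoffSum T k n z = 0 := by
      have : birkhoffSum T k n z = birkhoffSum T (fun x => F x + e x) n z - n * A := by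
        rw [← birkhoffSum_const_real T A n z]
        exact Finset.sum_sub_distrib _ _
      rw [this, hnA, sub_self]
    have hky : birkhoffSum T k m (T^[i] z) ≤ n * (2 * δ) + ε * ρ' / 4 := by
      have hy : T^[n] (T^[i] z) = T^[i] z := by
        rw [← Function.iterate_add_apply, add_comm, Function.iterate_add_apply, hz]
      rw [← Nat.div_add_mod' m n, birkhoffSum_add, birkhoffSum_mul_of_iterate_eq hy,
        birkhoffSum_iterate_of_iterate_eq hz, hkz, mul_zero, zero_add]
      have h3 : birkhoffSum T k (m % n) (T^[m / n * n] (T^[i] z)) ≤ (m % n : ℕ) * (δ + -A) := by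
        rw [← birkhoffSum_const_real T (δ + -A) (m % n) (T^[m / n * n] (T^[i] z))]
        refine Finset.sum_le_sum fun j _ => ?_
        have := hF0 (T^[j] (T^[m / n * n] (T^[i] z)))
        have := le_of_abs_le (he (T^[j] (T^[m / n * n] (T^[i] z))))
        simp only [hk]
        linarith
      have h4 : ((m % n : ℕ) : ℝ) ≤ n := by exact_mod_cast (Nat.mod_lt m hn).le
      have h5 : (0 : ℝ) ≤ (m % n : ℕ) := by positivity
      have h6 : 0 ≤ n * δ := by positivity
      refine h3.trans ?_
      rcases le_total 0 (δ + -A) with h7 | h7 <;> nlinarith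
    have h3 := le_of_abs_le (abs_birkhoffSum_sub_le (T := T) hklip m x (T^[i] z))
    have h4 : birkhoffSum T (fun x => F x - ε * q x + e x - A) m x ≤ birkhoffSum T k m x :=
      Finset.sum_le_sum fun j _ => by
        have : 0 ≤ ε * q (T^[j] x) := mul_nonneg hε.le (hq0 _)
        simp only [hk]
        linarith
    have h5 := hT.sum_dist_le_of_forall_lt (x := x) (y := T^[i] z) (m := m) hρ'.le (by linarith)
      fun t ht => by
        have := h t ht
        rwa [add_comm, Function.iterate_add_apply] at this
    have h6 : (C + δ) * ∑ t ∈ Finset.range m, dist (T^[t] x) (T^[t] (T^[i] z)) ≤ ε * ρ / 8 := by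
      refine le_trans ?_ hCδ
      gcongr
      rwa [le_div_iff₀' h1']
    linarith

end IsOpenExpanding

namespace IsOpenExpanding

variable {X : Type*} [MetricSpace X] {T : X → X} {lam η : ℝ}

/-- For every Lipschitz function there is a periodic orbit that remains maximizing after
subtracting any function growing at least linearly away from the orbit and adding any small
Lipschitz perturbation. -/
theorem exists_locking_orbit [CompactSpace X] [Nonempty X] (hT : IsOpenExpanding T lam η) {L : ℝ}
    (hL0 : 0 ≤ L) (hL : ∀ x y, dist (T x) (T y) ≤ L * dist x y) {φ : X → ℝ} {C : ℝ} (hC : 0 ≤ C)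
    (hφ : ∀ x y, |φ x - φ y| ≤ C * dist x y) {ε : ℝ} (hε : 0 < ε) :
    ∃ n z, 0 < n ∧ T^[n] z = z ∧ ∃ δ > 0, ∀ q e : X → ℝ, (∀ x, 0 ≤ q x) →
      (∀ i, q (T^[i] z) = 0) → (∀ x, ∃ i, dist x (T^[i] z) ≤ q x) → (∀ x, |e x| ≤ δ) →
      (∀ x y, |e x - e y| ≤ δ * dist x y) → ∃ B, ∀ N x,
        n * birkhoffSum T (fun x => φ x - ε * q x + e x) N x ≤
          B + N * birkhoffSum T (fun x => φ x - ε * q x + e x) n z := by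
  have h1 : 0 < lam - 1 := by linarith [hT.one_lt]
  have hc : Continuous T := (LipschitzWith.of_dist_le' hL).continuous
  obtain ⟨Q, hQ, hQ'⟩ := hT.exists_max_periodic_average hc (continuous_of_abs_sub_le hφ)
  obtain ⟨h, D, hD, hh, hsub⟩ := hT.exists_subaction hc (g := fun x => φ x - Q) hC
    (fun x y => by simpa using hφ x y) fun n x hn hx => by
      have : birkhoffSum T (fun x => φ x - Q) n x = birkhoffSum T φ n x - n * Q := by
        rw [← birkhoffSum_const_real T Q n x]
        exact Finset.sum_sub_distrib _ _
      rw [this]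
      linarith [hQ n x hn hx]
  set F : X → ℝ := fun x => φ x - Q + h x - h (T x) with hF
  have hsum : ∀ N x, birkhoffSum T F N x = birkhoffSum T φ N x - N * Q + h x - h (T^[N] x) := by
    intro N x
    have h2 : birkhoffSum T F N x = birkhoffSum T φ N x - birkhoffSum T (fun _ => Q) N x +
        birkhoffSum T (fun y => h y - h (T y)) N x := by
      simp only [birkhoffSum, hF, ← Finset.sum_sub_distrib, ← Finset.sum_add_distrib]
      exact Finset.sum_congr rfl fun i _ => by ring
    rw [h2, birkhoffSum_const_real, birkhoffSum_coboundary]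
    ring
  set M := C + D + D * L + 1 with hM
  have hM0 : 0 < M := by positivity
  have hFlip : ∀ x y, |F x - F y| ≤ M * dist x y := by
    intro x y
    have e1 : F x - F y = (φ x - φ y) + (h x - h y) + -(h (T x) - h (T y)) := by
      simp only [hF]; ring
    have e2 : |h (T x) - h (T y)| ≤ D * (L * dist x y) :=
      (hh _ _).trans (mul_le_mul_of_nonneg_left (hL x y) hD)
    have e3 := hφ x y
    have e4 := hh x y
    have e5 : 0 ≤ dist x y := dist_nonneg
    rw [e1]
    refine (abs_add_three _ _ _).trans ?_
    rw [abs_neg]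
    simp only [hM]
    nlinarith
  obtain ⟨Z, hZ, hZT, hFZ⟩ := exists_invariant_zero_set hc (continuous_of_abs_sub_le hFlip) hsub
    fun δ hδ => by
      obtain ⟨n, z, hn, hz, hlow⟩ := hQ' δ hδ
      refine ⟨n, z, hn, hz, ?_⟩
      rw [hsum, hz]
      linarith
  have hFdist : ∀ x, -F x ≤ M * Metric.infDist x Z := fun x => by
    rw [← div_le_iff₀' hM0, Metric.le_infDist hZ]
    intro y hy
    rw [div_le_iff₀' hM0]
    have := hFlip x y
    rw [hFZ y hy, sub_zero] at this
    exact (neg_le_abs _).trans this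
  set σ := min (1 / 4) (ε * (lam - 1) / (16 * (M + 1))) with hσ
  have hσ0 : 0 < σ := by positivity
  have hσ1 : σ ≤ 1 / 4 := min_le_left _ _
  have hσ2 : σ * (16 * (M + 1)) ≤ ε * (lam - 1) := by
    rw [← le_div_iff₀ (by positivity)]
    exact min_le_right _ _
  obtain ⟨n, z, γ, hn, hz, hγ, hγη, hs, hgap⟩ := hT.exists_gap_orbit hc hZ hZT
    (τ := ε * σ / (4 * (L + 2) * M)) (by positivity)
  set ρ := γ / (L + 2) with hρ
  have hρ0 : 0 < ρ := by positivity
  have hργ : (L + 2) * ρ = γ := by rw [hρ]; field_simp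
  have hnR : (0 : ℝ) < n := by exact_mod_cast hn
  refine ⟨n, z, hn, hz, min 1 (ε * (σ * ρ) / (16 * n)), by positivity,
    fun q e hq0 hqz hq he hel => ?_⟩
  obtain ⟨R, hR⟩ := (isCompact_univ.image (continuous_of_abs_sub_le hh).abs).bddAbove
  have hR' : ∀ x, |h x| ≤ R := fun x => hR ⟨x, mem_univ _, rfl⟩
  have hFz : -birkhoffSum T F n z ≤ ε * (σ * ρ) / 4 := by
    have e1 : -birkhoffSum T F n z ≤ M * birkhoffSum T (fun x => Metric.infDist x Z) n z := by
      rw [birkhoffSum, birkhoffSum, ← Finset.sum_neg_distrib, Finset.mul_sum]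
      exact Finset.sum_le_sum fun i _ => hFdist _
    refine e1.trans ((mul_le_mul_of_nonneg_left hs hM0.le).trans (le_of_eq ?_))
    rw [← hργ]
    field_simp
  have hCδ : (M + min 1 (ε * (σ * ρ) / (16 * n))) * (2 * (σ * ρ) / (lam - 1)) ≤ ε * ρ / 8 := by
    have e1 : M + min 1 (ε * (σ * ρ) / (16 * n)) ≤ M + 1 := by gcongr; exact min_le_left _ _
    refine (mul_le_mul_of_nonneg_right e1 (by positivity)).trans ?_
    rw [mul_div_assoc', div_le_iff₀ h1]
    nlinarith
  have key := hT.birkhoffSum_le_of_separated hL0 hL hn hz hγη hgap (ρ := ρ) (ρ' := σ * ρ)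
    (by positivity) (by nlinarith) hργ.le hε hM0.le hsub hFlip hFz (by positivity)
    (min_le_right _ _) hCδ hq0 hq he hel
  refine ⟨n * (ε * ρ / 2 + 2 * R), fun N x => ?_⟩
  have e1 : ∀ N x, birkhoffSum T (fun x => F x - ε * q x + e x) N x =
      birkhoffSum T (fun x => φ x - ε * q x + e x) N x - N * Q + h x - h (T^[N] x) := by
    intro N x
    have h2 := hsum N x
    have h3 : birkhoffSum T (fun x => F x - ε * q x + e x) N x = birkhoffSum T F N x +
        (birkhoffSum T (fun x => φ x - ε * q x + e x) N x - birkhoffSum T φ N x) := by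
      simp only [birkhoffSum, ← Finset.sum_sub_distrib, ← Finset.sum_add_distrib]
      exact Finset.sum_congr rfl fun i _ => by ring
    rw [h3, h2]
    ring
  have e2 : birkhoffSum T (fun x => F x + e x) n z =
      birkhoffSum T (fun x => F x - ε * q x + e x) n z :=
    Finset.sum_congr rfl fun i _ => by simp only [hqz i, mul_zero, sub_zero]
  have h4 := key N x
  rw [e2, e1, e1, hz] at h4
  have h5 := neg_le_of_abs_le (hR' x)
  have h6 := le_of_abs_le (hR' (T^[N] x))
  nlinarith

end IsOpenExpanding

theorem compactSpace_of_dist_le_rpow {X Y : Type*} [MetricSpace X] [MetricSpace Y] [CompactSpace X]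
    {p : X → Y} (hp : Function.Surjective p) {A α : ℝ} (hα : 0 < α)
    (h : ∀ x y, dist (p x) (p y) ≤ A * dist x y ^ α) : CompactSpace Y := by
  have hc : Continuous p := continuous_iff_continuousAt.2 fun x => by
    rw [ContinuousAt, tendsto_iff_dist_tendsto_zero]
    have h1 : Continuous fun y => A * dist y x ^ α :=
      continuous_const.mul ((continuous_id.dist continuous_const).rpow_const fun _ => Or.inr hα.le)
    refine squeeze_zero (fun _ => dist_nonneg) (fun y => h y x) ?_
    simpa [Real.zero_rpow hα.ne'] using h1.tendsto x
  exact ⟨by rw [← hp.range_eq]; exact isCompact_range hc⟩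

theorem exists_lt_iterate_eq {X : Type*} {T : X → X} {n : ℕ} {z : X} (hn : 0 < n)
    (hz : T^[n] z = z) (i : ℕ) : ∃ j < n, T^[j] z = T^[i] z :=
  have hp : Function.IsPeriodicPt T n z := hz
  ⟨i % n, Nat.mod_lt i hn, hp.iterate_mod_apply i⟩

theorem finite_range_iterate {X : Type*} {T : X → X} {n : ℕ} {z : X} (hn : 0 < n)
    (hz : T^[n] z = z) : (range fun i => T^[i] z).Finite := by
  refine ((Finset.range n).finite_toSet.image fun i => T^[i] z).subset ?_
  rintro _ ⟨i, rfl⟩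
  obtain ⟨j, hj, h⟩ := exists_lt_iterate_eq hn hz i
  exact ⟨j, by simpa using hj, h⟩

/-- The adapted distance turning an eventually expanding map into an expanding one. -/
noncomputable def adaptedDist {Y : Type*} [MetricSpace Y] (T : Y → Y) (N : ℕ) (lam α : ℝ)
    (x y : Y) : ℝ :=
  ∑ i ∈ Finset.range N, lam⁻¹ ^ i * dist (T^[i] x) (T^[i] y) ^ α

section Adapted

variable {Y : Type*} [MetricSpace Y] {T : Y → Y} {N : ℕ} {lam α : ℝ}

theorem rpow_dist_le_adaptedDist (hN : 0 < N) (hlam : 0 < lam) (x y : Y) :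
    dist x y ^ α ≤ adaptedDist T N lam α x y := by
  obtain ⟨N, rfl⟩ : ∃ k, N = k + 1 := ⟨N - 1, by omega⟩
  rw [adaptedDist, Finset.sum_range_succ']
  simp only [pow_zero, Function.iterate_zero, id_eq, one_mul]
  have : 0 ≤ ∑ i ∈ Finset.range N, lam⁻¹ ^ (i + 1) * dist (T^[i + 1] x) (T^[i + 1] y) ^ α :=
    Finset.sum_nonneg fun i _ => by positivity
  linarith

/-- The metric space structure given by the adapted distance. -/
noncomputable abbrev adaptedMetricSpace (T : Y → Y) (hN : 0 < N) (hlam : 0 < lam) (hα : 0 < α)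
    (hα1 : α ≤ 1) : MetricSpace Y where
  dist := adaptedDist T N lam α
  dist_self x := by simp [adaptedDist, Real.zero_rpow hα.ne']
  dist_comm x y := by simp only [adaptedDist, dist_comm]
  dist_triangle x y z := by
    show adaptedDist T N lam α x z ≤ adaptedDist T N lam α x y + adaptedDist T N lam α y z
    rw [adaptedDist, adaptedDist, adaptedDist, ← Finset.sum_add_distrib]
    refine Finset.sum_le_sum fun i _ => ?_
    rw [← mul_add]
    gcongr
    exact (Real.rpow_le_rpow dist_nonneg (dist_triangle _ _ _) hα.le).trans
      (Real.rpow_add_le_add_rpow dist_nonneg dist_nonneg hα.le hα1)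
  eq_of_dist_eq_zero {x y} h := by
    have h1 := rpow_dist_le_adaptedDist (T := T) (α := α) hN hlam x y
    have h2 : adaptedDist T N lam α x y = 0 := h
    have h3 : dist x y ^ α = 0 := le_antisymm (h2 ▸ h1) (by positivity)
    exact dist_eq_zero.1 ((Real.rpow_eq_zero dist_nonneg hα.ne').1 h3)

theorem adaptedDist_map (hlam : 0 < lam) (x y : Y) :
    adaptedDist T N lam α (T x) (T y) = lam * (adaptedDist T N lam α x y - dist x y ^ α +
      lam⁻¹ ^ N * dist (T^[N] x) (T^[N] y) ^ α) := by
  have h1 := Finset.sum_range_succ' (fun i => lam⁻¹ ^ i * dist (T^[i] x) (T^[i] y) ^ α) N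
  have h2 := Finset.sum_range_succ (fun i => lam⁻¹ ^ i * dist (T^[i] x) (T^[i] y) ^ α) N
  have h3 : adaptedDist T N lam α (T x) (T y) = lam *
      ∑ i ∈ Finset.range N, lam⁻¹ ^ (i + 1) * dist (T^[i + 1] x) (T^[i + 1] y) ^ α := by
    rw [adaptedDist, Finset.mul_sum]
    refine Finset.sum_congr rfl fun i _ => ?_
    rw [pow_succ]
    simp only [Function.iterate_succ_apply]
    field_simp
  simp only [pow_zero, Function.iterate_zero, id_eq, one_mul] at h1
  rw [h3]
  congr 1
  rw [adaptedDist]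
  linarith

theorem dist_iterate_le_pow {L : ℝ} (hL0 : 0 ≤ L) (hL : ∀ x y, dist (T x) (T y) ≤ L * dist x y)
    (i : ℕ) (x y : Y) : dist (T^[i] x) (T^[i] y) ≤ L ^ i * dist x y := by
  induction i with
  | zero => simp
  | succ i ih =>
    rw [Function.iterate_succ_apply', Function.iterate_succ_apply']
    calc _ ≤ L * dist (T^[i] x) (T^[i] y) := hL _ _
      _ ≤ L * (L ^ i * dist x y) := by gcongr
      _ = _ := by ring

theorem adaptedDist_le {L : ℝ} (hL0 : 0 ≤ L) (hL : ∀ x y, dist (T x) (T y) ≤ L * dist x y)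
    (hlam : 0 < lam) (hα : 0 < α) (x y : Y) : adaptedDist T N lam α x y ≤
      (∑ i ∈ Finset.range N, lam⁻¹ ^ i * (L ^ i) ^ α) * dist x y ^ α := by
  rw [adaptedDist, Finset.sum_mul]
  refine Finset.sum_le_sum fun i _ => ?_
  rw [mul_assoc, ← Real.mul_rpow (by positivity) dist_nonneg]
  gcongr
  exact dist_iterate_le_pow hL0 hL i x y

theorem adaptedDist_map_le {L : ℝ} (hL0 : 0 ≤ L) (hL : ∀ x y, dist (T x) (T y) ≤ L * dist x y)
    (hlam : 0 < lam) (hα : 0 < α) (x y : Y) : adaptedDist T N lam α (T x) (T y) ≤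
      L ^ α * adaptedDist T N lam α x y := by
  rw [adaptedDist, adaptedDist, Finset.mul_sum]
  refine Finset.sum_le_sum fun i _ => ?_
  rw [mul_left_comm, ← Real.mul_rpow (by positivity) dist_nonneg, ← Function.iterate_succ_apply,
    ← Function.iterate_succ_apply, Function.iterate_succ_apply', Function.iterate_succ_apply']
  gcongr
  exact hL _ _

theorem isOpenExpanding_adapted (hN : 0 < N) (hα : 0 < α) (hα1 : α ≤ 1) (hlam : 1 < lam)
    (hlam2 : lam ≤ 2) {κ r t : ℝ} (hκ : 0 ≤ κ) (hκlam : lam ^ N ≤ κ ^ α) (hr : 0 < r)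
    (hexp : ∀ x y, dist x y < r → κ * dist x y ≤ dist (T^[N] x) (T^[N] y)) (ht : 0 < t)
    (hlift : ∀ x y, dist (T x) y < t → ∃ x', T x' = y ∧ dist x x' < r) :
    ∃ η, @IsOpenExpanding Y (adaptedMetricSpace T hN (one_pos.trans hlam) hα hα1) T lam η := by
  have hlam0 := one_pos.trans hlam
  have hexp' : ∀ x y, dist x y < r →
      lam * adaptedDist T N lam α x y ≤ adaptedDist T N lam α (T x) (T y) := by
    intro x y h
    rw [adaptedDist_map hlam0]
    gcongr
    have h1 : dist x y ^ α ≤ lam⁻¹ ^ N * dist (T^[N] x) (T^[N] y) ^ α := by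
      rw [inv_pow, inv_mul_eq_div, le_div_iff₀' (by positivity)]
      calc lam ^ N * dist x y ^ α ≤ κ ^ α * dist x y ^ α := by gcongr
        _ = (κ * dist x y) ^ α := (Real.mul_rpow hκ dist_nonneg).symm
        _ ≤ _ := by gcongr; exact hexp x y h
    linarith
  have hsmall : ∀ s, 0 < s → ∀ x y, adaptedDist T N lam α x y ≤ s ^ α / 2 → dist x y < s := by
    intro s hs x y h
    have h1 := rpow_dist_le_adaptedDist (T := T) (α := α) hN hlam0 x y
    have h2 : 0 < s ^ α := by positivity
    exact (Real.rpow_lt_rpow_iff dist_nonneg hs.le hα).1 (by linarith)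
  refine ⟨min (r ^ α / 2) (t ^ α / 2), @IsOpenExpanding.mk Y
    (adaptedMetricSpace T hN hlam0 hα hα1) T lam _ hlam hlam2 (by positivity) ?_ ?_⟩
  · intro x y h
    exact hexp' x y (hsmall r hr x y (le_trans h (min_le_left _ _)))
  · intro x y h
    obtain ⟨x', rfl, h'⟩ := hlift x y (hsmall t ht _ _ (le_trans h (min_le_right _ _)))
    exact ⟨x', rfl, hexp' x x' h'⟩

theorem exists_adapted_rate (hN : 0 < N) (hα : 0 < α) {κ : ℝ} (hκ : 1 < κ) :
    ∃ lam, 1 < lam ∧ lam ≤ 2 ∧ lam ^ N ≤ κ ^ α := by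
  have hNR : (0 : ℝ) < N := by exact_mod_cast hN
  refine ⟨min 2 (κ ^ (α / N)), lt_min one_lt_two (Real.one_lt_rpow hκ (by positivity)),
    min_le_left _ _, ?_⟩
  calc _ ≤ (κ ^ (α / N)) ^ N := by gcongr; exact min_le_right _ _
    _ = κ ^ α := by
      rw [← Real.rpow_natCast, ← Real.rpow_mul (by linarith)]
      congr 1
      field_simp

/-- For an open, eventually expanding map, a Hölder function minus a multiple of the distance to a
suitable periodic orbit is robustly maximized by that orbit. -/
theorem exists_holder_locking_orbit [CompactSpace Y] [Nonempty Y] {L : ℝ} (hL0 : 0 ≤ L)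
    (hL : ∀ x y, dist (T x) (T y) ≤ L * dist x y) (hN : 0 < N) {κ r t : ℝ} (hκ : 1 < κ)
    (hr : 0 < r) (hexp : ∀ x y, dist x y < r → κ * dist x y ≤ dist (T^[N] x) (T^[N] y))
    (ht : 0 < t) (hlift : ∀ x y, dist (T x) y < t → ∃ x', T x' = y ∧ dist x x' < r)
    (hα : 0 < α) (hα1 : α ≤ 1) {φ : Y → ℝ} {C : ℝ} (hC : 0 ≤ C)
    (hφ : ∀ x y, |φ x - φ y| ≤ C * dist x y ^ α) {ε : ℝ} (hε : 0 < ε) :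
    ∃ n z, 0 < n ∧ T^[n] z = z ∧ ∃ δ > 0, ∀ e : Y → ℝ, (∀ x, |e x| ≤ δ) →
      (∀ x y, |e x - e y| ≤ δ * dist x y ^ α) → ∃ B, ∀ k x,
        n * birkhoffSum T (fun x => φ x - ε * Metric.infDist x (range fun i => T^[i] z) ^ α + e x)
          k x ≤ B + k * birkhoffSum T
            (fun x => φ x - ε * Metric.infDist x (range fun i => T^[i] z) ^ α + e x) n z := by
  obtain ⟨lam, hlam, hlam2, hκlam⟩ := exists_adapted_rate hN hα hκ
  have hlam0 := one_pos.trans hlam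
  obtain ⟨η, hT⟩ := isOpenExpanding_adapted hN hα hα1 hlam hlam2 (by linarith) hκlam hr hexp ht
    hlift
  set A := ∑ i ∈ Finset.range N, lam⁻¹ ^ i * (L ^ i) ^ α with hA
  have hA0 : 0 ≤ A := Finset.sum_nonneg fun i _ => by positivity
  have hle := fun x y => rpow_dist_le_adaptedDist (T := T) (α := α) hN hlam0 x y
  have hcomp : @CompactSpace Y (adaptedMetricSpace T hN hlam0 hα
      hα1).toPseudoMetricSpace.toUniformSpace.toTopologicalSpace :=
    @compactSpace_of_dist_le_rpow Y Y _ (adaptedMetricSpace T hN hlam0 hα hα1) _ id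
      Function.surjective_id A α hα fun x y => adaptedDist_le hL0 hL hlam0 hα x y
  obtain ⟨n, z, hn, hz, δ, hδ, h⟩ := @IsOpenExpanding.exists_locking_orbit Y
    (adaptedMetricSpace T hN hlam0 hα hα1) T lam η hcomp _ hT (L ^ α) (by positivity)
    (fun x y => adaptedDist_map_le hL0 hL hlam0 hα x y) φ C hC
    (fun x y => (hφ x y).trans (mul_le_mul_of_nonneg_left (hle x y) hC)) (ε / (A + 1))
    (by positivity)
  refine ⟨n, z, hn, hz, δ, hδ, fun e he hel => ?_⟩
  have hfin := finite_range_iterate hn hz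
  have := h (fun x => (A + 1) * Metric.infDist x (range fun i => T^[i] z) ^ α) e
    (fun x => by have := Metric.infDist_nonneg (x := x) (s := range fun i => T^[i] z); positivity)
    (fun i => by
      rw [Metric.infDist_zero_of_mem (mem_range_self (f := fun i => T^[i] z) i), Real.zero_rpow hα.ne', mul_zero])
    (fun x => by
      obtain ⟨_, ⟨i, rfl⟩, hi⟩ := hfin.isCompact.exists_infDist_eq_dist (range_nonempty _) x
      refine ⟨i, ?_⟩
      rw [hi]
      refine (adaptedDist_le hL0 hL hlam0 hα x (T^[i] z)).trans ?_
      gcongr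
      linarith)
    he (fun x y => (hel x y).trans (mul_le_mul_of_nonneg_left (hle x y) hδ.le))
  have hA1 : A + 1 ≠ 0 := by positivity
  simp only [← mul_assoc, div_mul_cancel₀ ε hA1] at this
  exact this

end Adapted

theorem ContDiffOn.exists_abs_sub_le {f : ℝ → ℝ} {a b : ℝ} (hf : ContDiffOn ℝ 1 f (Icc a b))
    (hab : a < b) : ∃ L, 1 ≤ L ∧ ∀ x ∈ Icc a b, ∀ y ∈ Icc a b, |f x - f y| ≤ L * |x - y| := by
  obtain ⟨M, hM⟩ := isCompact_Icc.exists_bound_of_continuousOn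
    (hf.continuousOn_derivWithin (uniqueDiffOn_Icc hab) le_rfl)
  refine ⟨max 1 M, le_max_left _ _, fun x hx y hy => ?_⟩
  exact (convex_Icc a b).norm_image_sub_le_of_norm_derivWithin_le (hf.differentiableOn one_ne_zero)
    (fun z hz => (hM z hz).trans (le_max_right _ _)) hy hx

theorem ContDiffOn.iterate_of_mapsTo {f : ℝ → ℝ} {S : Set ℝ} (hf : ContDiffOn ℝ 1 f S)
    (hmaps : MapsTo f S S) : ∀ n, ContDiffOn ℝ 1 f^[n] S
  | 0 => contDiffOn_id
  | n + 1 => (hf.iterate_of_mapsTo hmaps n).comp hf hmaps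

/-- A `C¹` map whose derivative is large on a set expands distances near that set. -/
theorem ContDiffOn.exists_mul_abs_sub_le {g : ℝ → ℝ} {a b : ℝ} (hg : ContDiffOn ℝ 1 g (Icc a b))
    (hab : a < b) {K : Set ℝ} (hK : K ⊆ Icc a b) {c c' : ℝ} (hc : c < c')
    (hder : ∀ x ∈ K, c' ≤ |derivWithin g (Icc a b) x|) :
    ∃ r > 0, ∀ x ∈ K, ∀ u ∈ Icc a b, ∀ v ∈ Icc a b, |u - x| < r → |v - x| < r →
      c * |u - v| ≤ |g u - g v| := by
  have hunif := isCompact_Icc.uniformContinuousOn_of_continuous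
    (hg.continuousOn_derivWithin (uniqueDiffOn_Icc hab) le_rfl)
  obtain ⟨r, hr, h⟩ := Metric.uniformContinuousOn_iff.1 hunif (c' - c) (by linarith)
  refine ⟨r, hr, fun x hx u hu v hv hux hvx => ?_⟩
  wlog huv : u ≤ v generalizing u v
  · rw [abs_sub_comm, abs_sub_comm (g u)]
    exact this v hv u hu hvx hux (not_le.1 huv).le
  rcases huv.eq_or_lt with rfl | huv
  · simp
  have hsub : Icc u v ⊆ Icc a b := Icc_subset_Icc hu.1 hv.2
  obtain ⟨w, hw, hslope⟩ := exists_deriv_eq_slope g huv (hg.continuousOn.mono hsub)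
    ((hg.differentiableOn one_ne_zero).mono (Ioo_subset_Icc_self.trans hsub))
  have hwI : w ∈ Ioo a b := ⟨hu.1.trans_lt hw.1, hw.2.trans_le hv.2⟩
  rw [← derivWithin_of_mem_nhds (Icc_mem_nhds hwI.1 hwI.2)] at hslope
  have hwx : |w - x| < r := by
    rw [abs_lt] at *
    constructor <;> linarith [hw.1, hw.2]
  have h1 := h x (hK hx) w (Ioo_subset_Icc_self hwI) (by rwa [dist_comm, Real.dist_eq])
  rw [Real.dist_eq] at h1
  have h2 := hder x hx
  have h3 := abs_sub_abs_le_abs_sub (derivWithin g (Icc a b) x) (derivWithin g (Icc a b) w)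
  have h4 : c ≤ |derivWithin g (Icc a b) w| := by linarith
  rw [hslope, abs_div, le_div_iff₀ (abs_pos.2 (sub_pos.2 huv).ne')] at h4
  rwa [abs_sub_comm, abs_sub_comm (g u)]

theorem exists_mem_Icc_eq_of_lt {g : ℝ → ℝ} {a b u v y : ℝ} (huv : u < v)
    (hg : ContinuousOn g (Icc u v)) (hm : MapsTo g (Icc u v) (Icc a b)) (hlt : g u < g v)
    (hy : y ∈ Icc a b) (hu : g u = a ∨ g u = b ∨ g u ≤ y) (hv : g v = a ∨ g v = b ∨ y ≤ g v) :
    ∃ x ∈ Icc u v, g x = y := by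
  have h1 := hm (left_mem_Icc.2 huv.le)
  have h2 := hm (right_mem_Icc.2 huv.le)
  refine intermediate_value_Icc huv.le hg ⟨?_, ?_⟩
  · rcases hu with h | h | h
    · exact h.le.trans hy.1
    · linarith [h2.2]
    · exact h
  · rcases hv with h | h | h
    · linarith [h1.1]
    · exact hy.2.trans h.ge
    · exact h

/-- A continuous map preserving the endpoints of an interval and expanding near `x` is locally
onto at `x`. -/
theorem exists_preimage_of_expanding {f : ℝ → ℝ} {a b : ℝ} (hab : a < b)
    (hf : ContinuousOn f (Icc a b)) (hmaps : MapsTo f (Icc a b) (Icc a b))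
    (hfa : f a ∈ ({a, b} : Set ℝ)) (hfb : f b ∈ ({a, b} : Set ℝ)) {x s c : ℝ}
    (hx : x ∈ Icc a b) (hs : 0 < s) (hc : 0 < c)
    (hexp : ∀ u ∈ Icc a b, ∀ v ∈ Icc a b, |u - x| ≤ s → |v - x| ≤ s →
      c * |u - v| ≤ |f u - f v|) {y : ℝ} (hy : y ∈ Icc a b) (hxy : |f x - y| < c * s) :
    ∃ x' ∈ Icc a b, f x' = y ∧ |x - x'| ≤ s := by
  set u := max a (x - s) with hu
  set v := min b (x + s) with hv
  have hux : u ≤ x := max_le hx.1 (by linarith)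
  have hxv : x ≤ v := le_min hx.2 (by linarith)
  have huv : u < v := by
    rcases hux.lt_or_eq with h | h
    · exact h.trans_le hxv
    · have : a = x := by
        rcases max_choice a (x - s) with h' | h' <;> rw [hu, h'] at h
        · exact h
        · linarith
      exact h.trans_lt (lt_min (this ▸ hab) (by linarith))
  have hsub : Icc u v ⊆ Icc a b := Icc_subset_Icc (le_max_left _ _) (min_le_left _ _)
  have hball : ∀ w ∈ Icc u v, |w - x| ≤ s := fun w hw => by
    rw [abs_le]
    constructor
    · linarith [hw.1, le_max_right a (x - s)]
    · linarith [hw.2, min_le_right b (x + s)]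
  have hinj : InjOn f (Icc u v) := fun w hw w' hw' h => by
    have h1 := hexp w (hsub hw) w' (hsub hw') (hball w hw) (hball w' hw')
    rw [h, sub_self, abs_zero] at h1
    have h2 : |w - w'| ≤ 0 := by
      by_contra! h3
      have := mul_pos hc h3
      linarith
    rwa [abs_nonpos_iff, sub_eq_zero] at h2
  have humem : u ∈ Icc u v := left_mem_Icc.2 huv.le
  have hvmem : v ∈ Icc u v := right_mem_Icc.2 huv.le
  have hxmem : x ∈ Icc u v := ⟨hux, hxv⟩
  have hfu : f u = a ∨ f u = b ∨ |f x - y| < |f u - f x| := by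
    rcases max_choice a (x - s) with h | h
    · rw [hu, h]
      rcases hfa with h' | h'
      exacts [Or.inl h', Or.inr (Or.inl h')]
    · have h1 := hexp u (hsub humem) x hx (hball u humem) (by simpa using hs.le)
      rw [show u - x = -s by rw [hu, h]; ring, abs_neg, abs_of_pos hs] at h1
      exact Or.inr (Or.inr (hxy.trans_le h1))
  have hfv : f v = a ∨ f v = b ∨ |f x - y| < |f v - f x| := by
    rcases min_choice b (x + s) with h | h
    · rw [hv, h]
      rcases hfb with h' | h'
      exacts [Or.inl h', Or.inr (Or.inl h')]
    · have h1 := hexp v (hsub hvmem) x hx (hball v hvmem) (by simpa using hs.le)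
      rw [show v - x = s by rw [hv, h]; ring, abs_of_pos hs] at h1
      exact Or.inr (Or.inr (hxy.trans_le h1))
  suffices ∃ x' ∈ Icc u v, f x' = y by
    obtain ⟨x', hx', rfl⟩ := this
    exact ⟨x', hsub hx', rfl, by rw [abs_sub_comm]; exact hball x' hx'⟩
  have hcont := hf.mono hsub
  rcases ContinuousOn.strictMonoOn_of_injOn_Icc' huv.le hcont hinj with hmono | hanti
  · have h1 := hmono.monotoneOn humem hxmem hux
    have h2 := hmono.monotoneOn hxmem hvmem hxv
    refine exists_mem_Icc_eq_of_lt huv hcont (hmaps.mono_left hsub) (hmono humem hvmem huv) hy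
      (hfu.imp_right (Or.imp_right fun h => ?_)) (hfv.imp_right (Or.imp_right fun h => ?_))
    · rw [abs_of_nonpos (show f u - f x ≤ 0 by linarith)] at h
      linarith [le_abs_self (f x - y)]
    · rw [abs_of_nonneg (show 0 ≤ f v - f x by linarith)] at h
      linarith [neg_le_abs (f x - y)]
  · have h1 := hanti.antitoneOn humem hxmem hux
    have h2 := hanti.antitoneOn hxmem hvmem hxv
    obtain ⟨x', hx', h⟩ := exists_mem_Icc_eq_of_lt (g := fun w => a + b - f w) (a := a) (b := b)
      (y := a + b - y) huv (continuousOn_const.sub hcont)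
      (fun w hw => by
        have := hmaps (hsub hw)
        constructor <;> linarith [this.1, this.2])
      (by linarith [hanti humem hvmem huv])
      (by constructor <;> linarith [hy.1, hy.2])
      (by
        rcases hfu with h | h | h
        · exact Or.inr (Or.inl (by linarith))
        · exact Or.inl (by linarith)
        · rw [abs_of_nonneg (show 0 ≤ f u - f x by linarith)] at h
          exact Or.inr (Or.inr (by linarith [neg_le_abs (f x - y)])))
      (by
        rcases hfv with h | h | h
        · exact Or.inr (Or.inl (by linarith))
        · exact Or.inl (by linarith)
        · rw [abs_of_nonpos (show f v - f x ≤ 0 by linarith)] at h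
          exact Or.inr (Or.inr (by linarith [le_abs_self (f x - y)])))
    exact ⟨x', hx', by linarith⟩

/-- The union of the attracting periodic orbits. -/
def attractor (f : ℝ → ℝ) (I : Set ℝ) : Set ℝ :=
  {z | ∃ y p, IsAttractingPeriodicPt f I y p ∧ ∃ i : ℕ, z = f^[i] y}

section Attractor

variable {f : ℝ → ℝ} {I K : Set ℝ}

theorem mapsTo_attractor : MapsTo f (attractor f I) (attractor f I) := by
  rintro _ ⟨y, p, hy, i, rfl⟩
  exact ⟨y, p, hy, i + 1, (Function.iterate_succ_apply' f i y).symm⟩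

theorem attractor_subset (hmaps : MapsTo f I I) : attractor f I ⊆ I := by
  rintro _ ⟨y, p, hy, i, rfl⟩
  exact hmaps.iterate i hy.1

theorem finite_attractor (hfin : {x | ∃ p : ℕ, IsAttractingPeriodicPt f I x p}.Finite) :
    (attractor f I).Finite := by
  refine (hfin.biUnion (t := fun y => range fun i => f^[i] y) ?_).subset ?_
  · rintro y ⟨p, -, hp, hy, -⟩
    exact finite_range_iterate hp hy
  · rintro _ ⟨y, p, hy, i, rfl⟩
    exact mem_biUnion (mem_ofPred_eq ▸ ⟨p, hy⟩) ⟨i, rfl⟩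

theorem IsHyperbolicOn.disjoint_attractor (hhyp : IsHyperbolicOn f I K)
    (hdiff : ∀ n, DifferentiableOn ℝ f^[n] I) (hunique : UniqueDiffOn ℝ I)
    (hmaps : MapsTo f I I) : Disjoint K (attractor f I) := by
  obtain ⟨-, -, hK, ⟨c, hc, θ, hθ, hexp⟩, -, -⟩ := hhyp
  rw [disjoint_left]
  rintro _ hz ⟨y, p, ⟨hyI, hp, hy, hd⟩, i, rfl⟩
  have hyK : y ∈ K := by
    have h1 := hK.iterate (p * i - i) hz
    rwa [← Function.iterate_add_apply, Nat.sub_add_cancel (Nat.le_mul_of_pos_left i hp),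
      Function.iterate_mul, Function.iterate_fixed hy] at h1
  obtain ⟨k, hk⟩ := pow_unbounded_of_one_lt (1 / c) hθ
  rw [div_lt_iff₀' hc] at hk
  have h1 := ((hdiff p y hyI).hasDerivWithinAt.iterate _ hy (hmaps.iterate p) (k + 1)).derivWithin
    (hunique y hyI)
  rw [← Function.iterate_mul] at h1
  have h2 := hexp y hyK (p * (k + 1)) (Nat.mul_pos hp k.succ_pos)
  rw [h1, abs_pow] at h2
  have h3 : |derivWithin f^[p] I y| ^ (k + 1) ≤ 1 := pow_le_one₀ (abs_nonneg _) hd.le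
  have h4 : θ ^ k ≤ θ ^ (p * (k + 1)) := pow_le_pow_right₀ hθ.le (by nlinarith)
  have h5 : c * θ ^ k ≤ c * θ ^ (p * (k + 1)) := by gcongr
  linarith

theorem IsHyperbolicOn.tendsto_infDist_attractor (hhyp : IsHyperbolicOn f I K) {x : ℝ}
    (hx : x ∈ I \ K) :
    Tendsto (fun n => Metric.infDist (f^[n] x) (attractor f I)) atTop (nhds 0) := by
  obtain ⟨y, p, hy, h⟩ := hhyp.2.2.2.2.2 x hx
  refine squeeze_zero (fun _ => Metric.infDist_nonneg) (fun n => ?_) h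
  exact Metric.infDist_le_infDist_of_subset (fun z ⟨i, hi⟩ => ⟨y, p, hy, i, hi⟩) ⟨y, 0, rfl⟩

theorem IsHyperbolicOn.nonempty_attractor (hhyp : IsHyperbolicOn f I K) {x : ℝ}
    (hx : x ∈ I \ K) : (attractor f I).Nonempty := by
  obtain ⟨y, p, hy, -⟩ := hhyp.2.2.2.2.2 x hx
  exact ⟨y, y, p, hy, 0, rfl⟩

theorem IsHyperbolicOn.mem_of_map_mem (hhyp : IsHyperbolicOn f I K)
    (hdisj : Disjoint K (attractor f I)) {x : ℝ} (hx : x ∈ I) (hfx : f x ∈ K) : x ∈ K := by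
  by_contra hxK
  have hne := hhyp.nonempty_attractor ⟨hx, hxK⟩
  have hcl : IsClosed (attractor f I) := (finite_attractor hhyp.2.2.2.2.1).isClosed
  obtain ⟨w, hw, hmin⟩ := hhyp.1.exists_isMinOn ⟨_, hfx⟩
    (Metric.continuous_infDist_pt (attractor f I)).continuousOn
  have hpos : 0 < Metric.infDist w (attractor f I) :=
    (hcl.notMem_iff_infDist_pos hne).1 (disjoint_left.1 hdisj hw)
  obtain ⟨n, hn⟩ := ((hhyp.tendsto_infDist_attractor ⟨hx, hxK⟩).eventually
    (gt_mem_nhds hpos)).exists_forall_of_atTop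
  have h1 := hn (n + 1) (Nat.le_succ n)
  rw [Function.iterate_succ_apply] at h1
  exact absurd (hmin (hhyp.2.2.1.iterate n hfx)) (not_le.2 h1)

end Attractor

theorem Set.Finite.exists_isolating_radius {A S : Set ℝ} (hA : A.Finite)
    (hS : ∀ x ∈ A, IsClosed (S \ {x})) :
    ∃ r > 0, ∀ x ∈ A, ∀ y ∈ S, |x - y| < r → x = y := by
  have h : ∀ᶠ r in nhdsWithin (0 : ℝ) (Ioi 0), ∀ x ∈ A, ∀ y ∈ S, |x - y| < r → x = y := by
    rw [eventually_all_finite hA]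
    intro x hx
    obtain ⟨r, hr, hball⟩ := Metric.isOpen_iff.1 (hS x hx).isOpen_compl x (by simp)
    filter_upwards [(eventually_le_nhds hr).filter_mono nhdsWithin_le_nhds] with s hs y hy hxy
    by_contra hne
    refine hball (show y ∈ Metric.ball x r from ?_) ⟨hy, fun h => hne h.symm⟩
    rw [Metric.mem_ball, dist_comm, Real.dist_eq]
    exact hxy.trans_le hs
  obtain ⟨r, h, hr⟩ := (h.and self_mem_nhdsWithin).exists
  exact ⟨r, hr, h⟩

/-- An endpoint-preserving hyperbolic interval map is expanding and open on the union of its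
hyperbolic set and its attracting orbits. -/
theorem IsHyperbolicOn.exists_expanding_radius {f : ℝ → ℝ} {a b : ℝ} {K : Set ℝ} (hab : a < b)
    (hf : ContDiffOn ℝ 1 f (Icc a b)) (hmaps : MapsTo f (Icc a b) (Icc a b))
    (hfa : f a ∈ ({a, b} : Set ℝ)) (hfb : f b ∈ ({a, b} : Set ℝ))
    (hhyp : IsHyperbolicOn f (Icc a b) K) : ∃ N r t, 0 < N ∧ 0 < r ∧ 0 < t ∧
      (∀ x ∈ K ∪ attractor f (Icc a b), ∀ y ∈ K ∪ attractor f (Icc a b), |x - y| < r →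
        2 * |x - y| ≤ |f^[N] x - f^[N] y|) ∧
      ∀ x ∈ K ∪ attractor f (Icc a b), ∀ y ∈ K ∪ attractor f (Icc a b), |f x - y| < t →
        ∃ x' ∈ K ∪ attractor f (Icc a b), f x' = y ∧ |x - x'| < r := by
  set A := attractor f (Icc a b) with hA
  have hdisj : Disjoint K A := hhyp.disjoint_attractor
    (fun n => (hf.iterate_of_mapsTo hmaps n).differentiableOn one_ne_zero)
    (uniqueDiffOn_Icc hab) hmaps
  have hback := fun x => hhyp.mem_of_map_mem hdisj (x := x)
  have hAfin : A.Finite := finite_attractor hhyp.2.2.2.2.1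
  obtain ⟨hKc, hKI, hKK, ⟨c, hc, θ, hθ, hexp⟩, -, -⟩ := hhyp
  obtain ⟨r₀, hr₀, hiso⟩ := hAfin.exists_isolating_radius (S := K ∪ A) fun x hx => by
    rw [union_sdiff_distrib, sdiff_singleton_eq_self (disjoint_right.1 hdisj hx)]
    exact hKc.isClosed.union (hAfin.subset sdiff_subset).isClosed
  have hiso' : ∀ x ∈ K ∪ A, ∀ y ∈ A, |x - y| < r₀ → x = y := fun x hx y hy h =>
    (hiso y hy x hx (by rwa [abs_sub_comm])).symm
  obtain ⟨n, hn⟩ := pow_unbounded_of_one_lt (3 / c) hθ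
  rw [div_lt_iff₀' hc] at hn
  obtain ⟨r₁, hr₁, hloc⟩ := (hf.iterate_of_mapsTo hmaps (n + 1)).exists_mul_abs_sub_le hab hKI
    (show (2 : ℝ) < 3 by norm_num) fun x hx => by
      refine hn.le.trans (le_trans ?_ (hexp x hx (n + 1) n.succ_pos))
      have := pow_le_pow_right₀ hθ.le n.le_succ
      gcongr
  obtain ⟨L, hL1, hL⟩ := hf.exists_abs_sub_le hab
  have hLn : ∀ k, ∀ x ∈ Icc a b, ∀ y ∈ Icc a b, |f^[k] x - f^[k] y| ≤ L ^ k * |x - y| := by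
    intro k x hx y hy
    induction k with
    | zero => simp
    | succ k ih =>
      rw [Function.iterate_succ_apply', Function.iterate_succ_apply', pow_succ', mul_assoc]
      exact (hL _ (hmaps.iterate k hx) _ (hmaps.iterate k hy)).trans (by gcongr)
  have hL0 : 0 < L ^ n := by positivity
  set r := min r₀ r₁ with hr
  have hrpos : 0 < r := lt_min hr₀ hr₁
  have hloc' : ∀ x ∈ K, ∀ u ∈ Icc a b, ∀ v ∈ Icc a b, |u - x| ≤ r / 2 → |v - x| ≤ r / 2 →
      2 / L ^ n * |u - v| ≤ |f u - f v| := by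
    intro x hx u hu v hv hux hvx
    have h1 := min_le_right r₀ r₁
    have h2 := hloc x hx u hu v hv (by linarith) (by linarith)
    have h3 := hLn n (f u) (hmaps hu) (f v) (hmaps hv)
    rw [Function.iterate_succ_apply, Function.iterate_succ_apply] at h2
    rw [div_mul_eq_mul_div, div_le_iff₀' hL0]
    exact h2.trans h3
  refine ⟨n + 1, r, min r₀ (2 / L ^ n * (r / 2)), n.succ_pos, hrpos, by positivity, ?_, ?_⟩
  · rintro x (hx | hx) y hy hxy
    · rcases hy with hy | hy
      · exact hloc x hx x (hKI hx) y (hKI hy) (by simpa using hr₁)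
          (by rw [abs_sub_comm]; exact hxy.trans_le (min_le_right _ _))
      · rw [hiso' x (Or.inl hx) y hy (hxy.trans_le (min_le_left _ _))]
        simp
    · rw [hiso x hx y hy (hxy.trans_le (min_le_left _ _))]
      simp
  · rintro x hx y hy hxy
    have hself : f x = y → ∃ x' ∈ K ∪ A, f x' = y ∧ |x - x'| < r := fun h =>
      ⟨x, hx, h, by simpa using hrpos⟩
    have hfxS : f x ∈ K ∪ A := hx.imp (fun h => hKK h) fun h => mapsTo_attractor h
    have hxy₀ := hxy.trans_le (min_le_left _ _)
    rcases hy with hy | hy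
    · rcases hx with hx | hx
      · obtain ⟨x', hx', rfl, hd⟩ := exists_preimage_of_expanding hab hf.continuousOn hmaps hfa hfb
          (hKI hx) (half_pos hrpos) (by positivity) (hloc' x hx) (hKI hy)
          (hxy.trans_le (min_le_right _ _))
        exact ⟨x', Or.inl (hback x' hx' hy), rfl, by linarith⟩
      · exact hself (hiso _ (mapsTo_attractor hx) y (Or.inl hy) hxy₀)
    · exact hself (hiso' _ hfxS y hy hxy₀)

theorem EqOn.iterate_of_mapsTo {X : Type*} {F f : X → X} {S : Set X} (h : EqOn F f S)
    (hmaps : MapsTo f S S) (n : ℕ) : EqOn F^[n] f^[n] S := by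
  intro x hx
  induction n with
  | zero => rfl
  | succ n ih =>
    rw [Function.iterate_succ_apply', Function.iterate_succ_apply', ih, h (hmaps.iterate n hx)]

theorem ContinuousOn.exists_continuous_eqOn_Icc {f : ℝ → ℝ} {a b : ℝ} (hab : a ≤ b)
    (hf : ContinuousOn f (Icc a b)) : ∃ F, Continuous F ∧ EqOn F f (Icc a b) :=
  ⟨IccExtend hab ((Icc a b).domRestrict f), hf.domRestrict.Icc_extend',
    fun _ hx => IccExtend_of_mem hab _ hx⟩

namespace IsInvProbOn

variable {f : ℝ → ℝ} {a b : ℝ} {μ : Measure ℝ}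

theorem ae_mem_Icc (hμ : IsInvProbOn f (Icc a b) μ) : ∀ᵐ x ∂μ, x ∈ Icc a b := by
  have := hμ.1
  exact (mem_ae_iff_prob_eq_one measurableSet_Icc).2 hμ.2.1

theorem measurePreserving (hμ : IsInvProbOn f (Icc a b) μ) {F : ℝ → ℝ} (hF : Continuous F)
    (h : EqOn F f (Icc a b)) : MeasurePreserving F μ μ := by
  refine ⟨hF.measurable, Measure.ext fun B hB => ?_⟩
  rw [Measure.map_apply hF.measurable hB, ← hμ.2.2 B hB]
  refine measure_congr ?_
  filter_upwards [hμ.ae_mem_Icc] with x hx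
  refine propext ⟨fun hxB => ⟨?_, hx⟩, fun hxB => ?_⟩
  · show f x ∈ B
    rw [← h hx]
    exact hxB
  · show F x ∈ B
    rw [h hx]
    exact hxB.1

theorem integrable_of_continuousOn (hμ : IsInvProbOn f (Icc a b) μ) {g : ℝ → ℝ}
    (hg : ContinuousOn g (Icc a b)) : Integrable g μ := by
  have := hμ.1
  have h1 := hg.integrableOn_compact (μ := μ) isCompact_Icc
  rwa [IntegrableOn, Measure.restrict_eq_self_of_ae_mem hμ.ae_mem_Icc] at h1

theorem integral_iterate (hμ : IsInvProbOn f (Icc a b) μ) (hab : a ≤ b)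
    (hf : ContinuousOn f (Icc a b)) (hmaps : MapsTo f (Icc a b) (Icc a b)) {g : ℝ → ℝ}
    (hg : ContinuousOn g (Icc a b)) (k : ℕ) : ∫ x, g (f^[k] x) ∂μ = ∫ x, g x ∂μ := by
  obtain ⟨F, hF, hFf⟩ := hf.exists_continuous_eqOn_Icc hab
  obtain ⟨G, hG, hGg⟩ := hg.exists_continuous_eqOn_Icc hab
  have hpres := (hμ.measurePreserving hF hFf).iterate k
  have h1 : ∫ x, g (f^[k] x) ∂μ = ∫ x, G (F^[k] x) ∂μ := by
    refine integral_congr_ae ?_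
    filter_upwards [hμ.ae_mem_Icc] with x hx
    rw [EqOn.iterate_of_mapsTo hFf hmaps k hx, hGg (hmaps.iterate k hx)]
  have h2 : ∫ x, g x ∂μ = ∫ x, G x ∂μ := by
    refine integral_congr_ae ?_
    filter_upwards [hμ.ae_mem_Icc] with x hx
    rw [hGg hx]
  rw [h1, h2]
  conv_rhs => rw [← hpres.map_eq]
  exact (integral_map hpres.measurable.aemeasurable hG.aestronglyMeasurable).symm

theorem integral_birkhoffSum (hμ : IsInvProbOn f (Icc a b) μ) (hab : a ≤ b)
    (hf : ContinuousOn f (Icc a b)) (hmaps : MapsTo f (Icc a b) (Icc a b)) {g : ℝ → ℝ}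
    (hg : ContinuousOn g (Icc a b)) (k : ℕ) :
    ∫ x, birkhoffSum f g k x ∂μ = k * ∫ x, g x ∂μ := by
  simp only [birkhoffSum]
  rw [integral_finsetSum]
  · simp [hμ.integral_iterate hab hf hmaps hg]
  · exact fun i _ => hμ.integrable_of_continuousOn
      (hg.comp (hf.iterate hmaps i) (hmaps.iterate i))

theorem continuousOn_birkhoffSum (hf : ContinuousOn f (Icc a b))
    (hmaps : MapsTo f (Icc a b) (Icc a b)) {g : ℝ → ℝ} (hg : ContinuousOn g (Icc a b)) (k : ℕ) :
    ContinuousOn (birkhoffSum f g k) (Icc a b) :=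
  continuousOn_finsetSum _ fun i _ => hg.comp (hf.iterate hmaps i) (hmaps.iterate i)

theorem mul_integral_le (hμ : IsInvProbOn f (Icc a b) μ) (hab : a ≤ b)
    (hf : ContinuousOn f (Icc a b)) (hmaps : MapsTo f (Icc a b) (Icc a b)) {g : ℝ → ℝ}
    (hg : ContinuousOn g (Icc a b)) {S : Set ℝ} (hS : ∀ᵐ x ∂μ, x ∈ S) {n B c : ℝ}
    (h : ∀ k : ℕ, ∀ x ∈ S, n * birkhoffSum f g k x ≤ B + k * c) : n * ∫ x, g x ∂μ ≤ c := by
  have := hμ.1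
  have key : ∀ k : ℕ, k * (n * ∫ x, g x ∂μ) ≤ B + k * c := by
    intro k
    have h1 : ∫ x, n * birkhoffSum f g k x ∂μ ≤ ∫ _, B + k * c ∂μ := by
      refine integral_mono_ae ?_ (integrable_const _) ?_
      · exact (hμ.integrable_of_continuousOn (continuousOn_birkhoffSum hf hmaps hg k)).const_mul n
      · filter_upwards [hS] with x hx using h k x hx
    rw [integral_const_mul, hμ.integral_birkhoffSum hab hf hmaps hg, integral_const, probReal_univ,
      one_smul] at h1
    linarith
  by_contra! hlt
  obtain ⟨k, hk⟩ := exists_nat_gt (B / (n * ∫ x, g x ∂μ - c))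
  rw [div_lt_iff₀ (by linarith)] at hk
  linarith [key k]

/-- Invariant measures of a hyperbolic map live on the hyperbolic set and the attracting orbits. -/
theorem ae_mem_core (hμ : IsInvProbOn f (Icc a b) μ) (hab : a ≤ b)
    (hf : ContinuousOn f (Icc a b)) (hmaps : MapsTo f (Icc a b) (Icc a b)) {K : Set ℝ}
    (hhyp : IsHyperbolicOn f (Icc a b) K) : ∀ᵐ x ∂μ, x ∈ K ∪ attractor f (Icc a b) := by
  have := hμ.1
  set A := attractor f (Icc a b) with hA
  have hW : MeasurableSet (Icc a b \ K) := measurableSet_Icc.diff hhyp.1.measurableSet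
  set u : ℝ → ℝ := (Icc a b \ K).indicator fun x => Metric.infDist x A with hu
  have hum : Measurable u := (Metric.continuous_infDist_pt A).measurable.indicator hW
  have hu0 : ∀ x, 0 ≤ u x := fun x => indicator_nonneg (fun _ _ => Metric.infDist_nonneg) x
  have hub : ∀ x, u x ≤ b - a := by
    intro x
    by_cases hx : x ∈ Icc a b \ K
    · obtain ⟨w, hw⟩ := hhyp.nonempty_attractor hx
      have hwI := attractor_subset hmaps hw
      rw [hu, indicator_of_mem hx]
      refine (Metric.infDist_le_dist_of_mem hw).trans ?_
      rw [Real.dist_eq, abs_le]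
      constructor <;> linarith [hwI.1, hwI.2, hx.1.1, hx.1.2]
    · rw [hu, indicator_of_notMem hx]
      linarith
  obtain ⟨F, hF, hFf⟩ := hf.exists_continuous_eqOn_Icc hab
  have hpres := fun n => (hμ.measurePreserving hF hFf).iterate n
  have hlim : Tendsto (fun n => ∫ x, u (F^[n] x) ∂μ) atTop (nhds (∫ _, (0 : ℝ) ∂μ)) := by
    refine tendsto_integral_of_dominated_convergence (fun _ => b - a)
      (fun n => (hum.comp (hpres n).measurable).aestronglyMeasurable) (integrable_const _)
      (fun n => Eventually.of_forall fun x => ?_) ?_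
    · rw [Real.norm_of_nonneg (hu0 _)]
      exact hub _
    · filter_upwards [hμ.ae_mem_Icc] with x hx
      simp only [EqOn.iterate_of_mapsTo hFf hmaps _ hx]
      by_cases hxK : x ∈ K
      · have : ∀ n, u (f^[n] x) = 0 := fun n =>
          indicator_of_notMem (fun h => h.2 (hhyp.2.2.1.iterate n hxK)) _
        simp only [this, tendsto_const_nhds]
      · exact squeeze_zero (fun _ => hu0 _)
          (fun n => indicator_le_self' (fun _ _ => Metric.infDist_nonneg) _)
          (hhyp.tendsto_infDist_attractor ⟨hx, hxK⟩)
  have hconst : ∀ n, ∫ x, u (F^[n] x) ∂μ = ∫ x, u x ∂μ := fun n => by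
    conv_rhs => rw [← (hpres n).map_eq]
    exact (integral_map (hpres n).measurable.aemeasurable hum.aestronglyMeasurable).symm
  simp only [hconst, integral_zero] at hlim
  have hzero := tendsto_nhds_unique tendsto_const_nhds hlim
  have hqint : Integrable u μ := (integrable_const (b - a)).mono' hum.aestronglyMeasurable
    (Eventually.of_forall fun x => by rw [Real.norm_of_nonneg (hu0 _)]; exact hub x)
  have hae := (integral_eq_zero_iff_of_nonneg hu0 hqint).1 hzero
  filter_upwards [hμ.ae_mem_Icc, hae] with x hx hux
  by_cases hxK : x ∈ K
  · exact Or.inl hxK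
  · right
    have hxW : x ∈ Icc a b \ K := ⟨hx, hxK⟩
    rw [hu, indicator_of_mem hxW] at hux
    exact ((finite_attractor hhyp.2.2.2.2.1).isClosed.mem_iff_infDist_zero
      (hhyp.nonempty_attractor ⟨hx, hxK⟩)).2 hux

end IsInvProbOn

theorem exists_interval_locking_orbit {f : ℝ → ℝ} {a b : ℝ} {K : Set ℝ} (hab : a < b)
    (hf : ContDiffOn ℝ 1 f (Icc a b)) (hmaps : MapsTo f (Icc a b) (Icc a b))
    (hfa : f a ∈ ({a, b} : Set ℝ)) (hfb : f b ∈ ({a, b} : Set ℝ))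
    (hhyp : IsHyperbolicOn f (Icc a b) K) {α : ℝ} (hα : 0 < α) (hα1 : α ≤ 1) {φ : ℝ → ℝ} {C : ℝ}
    (hC : 0 ≤ C) (hφ : ∀ x ∈ Icc a b, ∀ y ∈ Icc a b, |φ x - φ y| ≤ C * dist x y ^ α) {ε : ℝ}
    (hε : 0 < ε) : ∃ n, ∃ z ∈ Icc a b, 0 < n ∧ f^[n] z = z ∧ ∃ δ > 0, ∀ e : ℝ → ℝ,
      (∀ x ∈ Icc a b, |e x| ≤ δ) →
      (∀ x ∈ Icc a b, ∀ y ∈ Icc a b, |e x - e y| ≤ δ * dist x y ^ α) →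
      ∃ B, ∀ k : ℕ, ∀ x ∈ K ∪ attractor f (Icc a b),
        n * birkhoffSum f (fun x => φ x - ε * Metric.infDist x (range fun i => f^[i] z) ^ α + e x)
          k x ≤ B + k * birkhoffSum f
            (fun x => φ x - ε * Metric.infDist x (range fun i => f^[i] z) ^ α + e x) n z := by
  obtain ⟨L, hL1, hL⟩ := hf.exists_abs_sub_le hab
  obtain ⟨N, r, t, hN, hr, ht, hexp, hlift⟩ :=
    hhyp.exists_expanding_radius hab hf hmaps hfa hfb
  set S := K ∪ attractor f (Icc a b) with hS
  have hST : MapsTo f S S := hhyp.2.2.1.union_union mapsTo_attractor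
  have hSI : S ⊆ Icc a b := union_subset hhyp.2.1 (attractor_subset hmaps)
  have : CompactSpace S := isCompact_iff_compactSpace.1
    (hhyp.1.union (finite_attractor hhyp.2.2.2.2.1).isCompact)
  have : Nonempty S := by
    by_cases haK : a ∈ K
    · exact ⟨a, Or.inl haK⟩
    · obtain ⟨w, hw⟩ := hhyp.nonempty_attractor (x := a) ⟨left_mem_Icc.2 hab.le, haK⟩
      exact ⟨w, Or.inr hw⟩
  set T : S → S := hST.restrict f S S with hT
  have hcoe : ∀ (n : ℕ) (x : S), ((T^[n] x : S) : ℝ) = f^[n] x := fun n x =>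
    hST.coe_iterate_restrict x n
  obtain ⟨n, z, hn, hz, δ, hδ, h⟩ := exists_holder_locking_orbit (T := T) (by linarith)
    (fun x y => hL x (hSI x.2) y (hSI y.2)) hN (κ := 2) (by norm_num) hr
    (fun x y hxy => by
      simp only [Subtype.dist_eq, Real.dist_eq, hcoe] at hxy ⊢
      exact hexp x x.2 y y.2 hxy) ht
    (fun x y hxy => by
      obtain ⟨x', hx', h1, h2⟩ := hlift x x.2 y y.2 hxy
      exact ⟨⟨x', hx'⟩, Subtype.ext h1, h2⟩) hα hα1 (φ := fun x => φ x) hC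
    (fun x y => hφ x (hSI x.2) y (hSI y.2)) hε
  refine ⟨n, z, hSI z.2, hn, by rw [← hcoe, hz], δ, hδ, fun e he1 he2 => ?_⟩
  obtain ⟨B, hB⟩ := h (fun x => e x) (fun x => he1 x (hSI x.2))
    (fun x y => he2 x (hSI x.2) y (hSI y.2))
  have hrange : (range fun i => f^[i] (z : ℝ)) = (↑) '' (range fun i => T^[i] z) := by
    rw [← range_comp]
    exact congrArg range (funext fun i => (hcoe i z).symm)
  have hsum : ∀ (k : ℕ) (x : S),
      birkhoffSum T (fun x : S => φ x - ε * Metric.infDist x (range fun i => T^[i] z) ^ α + e x)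
        k x = birkhoffSum f
          (fun x => φ x - ε * Metric.infDist x (range fun i => f^[i] (z : ℝ)) ^ α + e x) k x := by
    intro k x
    refine Finset.sum_congr rfl fun i _ => ?_
    have hiso : Isometry ((↑) : S → ℝ) := isometry_subtype_coe
    rw [hrange]
    simp only [← hcoe, Metric.infDist_image hiso]
  refine ⟨B, fun k x hx => ?_⟩
  have := hB k ⟨x, hx⟩
  rwa [hsum, hsum] at this

theorem mem_image_iterate_iff {X : Type*} [DecidableEq X] {f : X → X} {n : ℕ} {z : X} (hn : 0 < n)
    (hz : f^[n] z = z) {x : X} :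
    x ∈ (Finset.range n).image (fun i => f^[i] z) ↔ ∃ i, f^[i] z = x := by
  simp only [Finset.mem_image, Finset.mem_range]
  constructor
  · rintro ⟨i, -, hi⟩
    exact ⟨i, hi⟩
  · rintro ⟨i, rfl⟩
    exact exists_lt_iterate_eq hn hz i

theorem orbitMeasure_apply (O : Finset ℝ) (B : Set ℝ) [DecidablePred (· ∈ B)] :
    orbitMeasure O B = (O.card : ENNReal)⁻¹ * (O.filter (· ∈ B)).card := by
  simp [orbitMeasure, Measure.dirac_apply, indicator_apply]

section PeriodicOrbit

variable {f : ℝ → ℝ} {n : ℕ} {z : ℝ}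

theorem bijOn_image_iterate (hn : 0 < n) (hz : f^[n] z = z) :
    BijOn f ((Finset.range n).image fun i => f^[i] z) ((Finset.range n).image fun i => f^[i] z) := by
  have hm : MapsTo f ((Finset.range n).image fun i => f^[i] z)
      ((Finset.range n).image fun i => f^[i] z) := by
    intro x hx
    rw [Finset.mem_coe, mem_image_iterate_iff hn hz] at hx ⊢
    obtain ⟨i, rfl⟩ := hx
    exact ⟨i + 1, Function.iterate_succ_apply' f i z⟩
  have hs : SurjOn f ((Finset.range n).image fun i => f^[i] z)
      ((Finset.range n).image fun i => f^[i] z) := by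
    intro x hx
    rw [Finset.mem_coe, mem_image_iterate_iff hn hz] at hx
    obtain ⟨i, rfl⟩ := hx
    refine ⟨f^[i + (n - 1)] z, ?_, ?_⟩
    · rw [Finset.mem_coe, mem_image_iterate_iff hn hz]
      exact ⟨_, rfl⟩
    · rw [← Function.iterate_succ_apply' f, show (i + (n - 1)).succ = i + n by omega,
        Function.iterate_add_apply, hz]
  exact ⟨hm, Finset.injOn_of_surjOn_of_card_le f hm hs le_rfl, hs⟩

theorem isInvProbOn_orbitMeasure {I : Set ℝ} (hmaps : MapsTo f I I) (hn : 0 < n)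
    (hz : f^[n] z = z) (hzI : z ∈ I) :
    IsInvProbOn f I (orbitMeasure ((Finset.range n).image fun i => f^[i] z)) := by
  classical
  set O := (Finset.range n).image fun i => f^[i] z with hO
  have hOI : ∀ x ∈ O, x ∈ I := by
    intro x hx
    obtain ⟨i, rfl⟩ := (mem_image_iterate_iff hn hz).1 hx
    exact hmaps.iterate i hzI
  have hcard : (O.card : ENNReal) ≠ 0 := by
    rw [Nat.cast_ne_zero, ← Nat.pos_iff_ne_zero, Finset.card_pos]
    exact ⟨z, (mem_image_iterate_iff hn hz).2 ⟨0, rfl⟩⟩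
  have hfull : ∀ B : Set ℝ, (∀ x ∈ O, x ∈ B) → orbitMeasure O B = 1 := by
    intro B hB
    rw [orbitMeasure_apply, Finset.filter_true_of_mem hB,
      ENNReal.inv_mul_cancel hcard (ENNReal.natCast_ne_top _)]
  refine ⟨⟨hfull _ fun _ _ => mem_univ _⟩, hfull _ hOI, fun B _ => ?_⟩
  rw [orbitMeasure_apply, orbitMeasure_apply]
  congr 2
  have hbij := bijOn_image_iterate hn hz
  refine Finset.card_bij (fun x _ => f x) ?_ ?_ ?_
  · intro x hx
    rw [Finset.mem_filter] at hx ⊢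
    exact ⟨hbij.mapsTo hx.1, hx.2.1⟩
  · intro x hx y hy hxy
    exact hbij.injOn (Finset.mem_filter.1 hx).1 (Finset.mem_filter.1 hy).1 hxy
  · intro y hy
    rw [Finset.mem_filter] at hy
    obtain ⟨x, hx, rfl⟩ := hbij.surjOn hy.1
    exact ⟨x, Finset.mem_filter.2 ⟨hx, hy.2, hOI x hx⟩, rfl⟩

theorem ae_orbitMeasure_mem (O : Finset ℝ) : ∀ᵐ x ∂orbitMeasure O, x ∈ O := by
  classical
  change (O : Set ℝ) ∈ ae (orbitMeasure O)
  rw [mem_ae_iff, orbitMeasure_apply]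
  simp

theorem mul_integral_orbitMeasure {a b : ℝ} (hab : a ≤ b) (hf : ContinuousOn f (Icc a b))
    (hmaps : MapsTo f (Icc a b) (Icc a b)) (hn : 0 < n) (hz : f^[n] z = z) (hzI : z ∈ Icc a b)
    {g : ℝ → ℝ} (hg : ContinuousOn g (Icc a b)) :
    n * ∫ x, g x ∂orbitMeasure ((Finset.range n).image fun i => f^[i] z) = birkhoffSum f g n z := by
  have hinv := isInvProbOn_orbitMeasure hmaps hn hz hzI
  have := hinv.1
  rw [← hinv.integral_birkhoffSum hab hf hmaps hg]
  have h : birkhoffSum f g n =ᵐ[orbitMeasure ((Finset.range n).image fun i => f^[i] z)]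
      fun _ => birkhoffSum f g n z := by
    filter_upwards [ae_orbitMeasure_mem _] with x hx
    obtain ⟨i, rfl⟩ := (mem_image_iterate_iff hn hz).1 hx
    exact birkhoffSum_iterate_of_iterate_eq hz g i
  rw [integral_congr_ae h, integral_const, probReal_univ, one_smul]

/-- The orbit measure is the only invariant probability measure carried by the orbit. -/
theorem IsInvProbOn.eq_orbitMeasure {I : Set ℝ} (hmaps : MapsTo f I I)
    (hz : f^[n] z = z) (hzI : z ∈ I) {μ : Measure ℝ} (hμ : IsInvProbOn f I μ)
    (hO : ∀ᵐ x ∂μ, x ∈ (Finset.range n).image fun i => f^[i] z) :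
    μ = orbitMeasure ((Finset.range n).image fun i => f^[i] z) := by
  classical
  have := hμ.1
  set O := (Finset.range n).image fun i => f^[i] z with hOdef
  have hstep : ∀ i, μ {f^[i] z} ≤ μ {f^[i + 1] z} := by
    intro i
    rw [← hμ.2.2 {f^[i + 1] z} (measurableSet_singleton _)]
    refine measure_mono (singleton_subset_iff.2 ⟨?_, hmaps.iterate i hzI⟩)
    exact (Function.iterate_succ_apply' f i z).symm
  have hmono : Monotone fun i => μ {f^[i] z} := monotone_nat_of_le_succ hstep
  have hconst : ∀ x ∈ O, μ {x} = μ {z} := by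
    intro x hx
    rw [hOdef, Finset.mem_image] at hx
    obtain ⟨i, hi, rfl⟩ := hx
    refine le_antisymm ?_ (hmono i.zero_le)
    have := hmono (Finset.mem_range.1 hi).le
    simpa [hz] using this
  have hsum : ∀ B : Set ℝ, μ B = (O.filter (· ∈ B)).card * μ {z} := by
    intro B
    have h1 : μ B = μ (O.filter (· ∈ B)) := by
      have h : ∀ᵐ x ∂μ, x ∈ B ↔ x ∈ (O.filter (· ∈ B) : Set ℝ) := by
        filter_upwards [hO] with x hx
        simp [hx]
      exact measure_congr (h.mono fun x hx => propext hx)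
    rw [h1, ← sum_measure_singleton, Finset.sum_congr rfl fun x hx =>
      hconst x (Finset.mem_filter.1 hx).1, Finset.sum_const, nsmul_eq_mul]
  have h1 : (O.card : ENNReal) * μ {z} = 1 := by
    have := hsum univ
    rw [measure_univ] at this
    simpa using this.symm
  have h2 : μ {z} = (O.card : ENNReal)⁻¹ := by
    rw [mul_comm] at h1
    exact ENNReal.eq_inv_of_mul_eq_one_left h1
  ext B _
  rw [hsum, h2, orbitMeasure_apply, mul_comm]

end PeriodicOrbit

theorem supNormOn_nonneg {X : Type*} (S : Set X) (φ : X → ℝ) : 0 ≤ supNormOn S φ :=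
  Real.sSup_nonneg <| by
    rintro _ ⟨x, -, rfl⟩
    exact abs_nonneg _

section HolderNorm

variable {X : Type*} [MetricSpace X] {α : ℝ} {S : Set X} {φ ψ : X → ℝ}

theorem IsHolderOn.exists_nonneg (h : IsHolderOn α S φ) :
    ∃ C, 0 ≤ C ∧ ∀ x ∈ S, ∀ y ∈ S, |φ x - φ y| ≤ C * dist x y ^ α := by
  obtain ⟨C, hC⟩ := h
  refine ⟨|C|, abs_nonneg C, fun x hx y hy => (hC x hx y hy).trans ?_⟩
  gcongr
  exact le_abs_self C

theorem IsHolderOn.add (hφ : IsHolderOn α S φ) (hψ : IsHolderOn α S ψ) :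
    IsHolderOn α S fun x => φ x + ψ x := by
  obtain ⟨C, hC⟩ := hφ
  obtain ⟨D, hD⟩ := hψ
  refine ⟨C + D, fun x hx y hy => ?_⟩
  calc |φ x + ψ x - (φ y + ψ y)| = |(φ x - φ y) + (ψ x - ψ y)| := by ring_nf
    _ ≤ |φ x - φ y| + |ψ x - ψ y| := abs_add_le _ _
    _ ≤ (C + D) * dist x y ^ α := by linarith [hC x hx y hy, hD x hx y hy]

theorem IsHolderOn.const_mul (c : ℝ) (hφ : IsHolderOn α S φ) : IsHolderOn α S fun x => c * φ x := by
  obtain ⟨C, hC⟩ := hφ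
  refine ⟨|c| * C, fun x hx y hy => ?_⟩
  rw [← mul_sub, abs_mul, mul_assoc]
  exact mul_le_mul_of_nonneg_left (hC x hx y hy) (abs_nonneg c)

theorem IsHolderOn.sub (hφ : IsHolderOn α S φ) (hψ : IsHolderOn α S ψ) :
    IsHolderOn α S fun x => φ x - ψ x := by
  simpa [sub_eq_add_neg] using hφ.add (hψ.const_mul (-1))

theorem IsHolderOn.continuousOn (hα : 0 < α) (h : IsHolderOn α S φ) : ContinuousOn φ S := by
  obtain ⟨C, hC⟩ := h
  intro x hx
  rw [ContinuousWithinAt, tendsto_iff_dist_tendsto_zero]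
  have h1 : Continuous fun y => C * dist y x ^ α :=
    continuous_const.mul ((continuous_id.dist continuous_const).rpow_const fun _ => Or.inr hα.le)
  have h2 : Tendsto (fun y => C * dist y x ^ α) (nhdsWithin x S) (nhds 0) := by
    simpa [Real.zero_rpow hα.ne'] using (h1.tendsto x).mono_left nhdsWithin_le_nhds
  refine squeeze_zero' (Eventually.of_forall fun _ => dist_nonneg) ?_ h2
  filter_upwards [self_mem_nhdsWithin] with y hy using hC y hy x hx

theorem holderSemiOn_nonneg (α : ℝ) (S : Set X) (φ : X → ℝ) : 0 ≤ holderSemiOn α S φ :=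
  Real.sInf_nonneg fun _ h => h.1

theorem IsHolderOn.abs_le_holderNormOn (hα : 0 < α) (hS : IsCompact S) (h : IsHolderOn α S φ)
    {x : X} (hx : x ∈ S) : |φ x| ≤ holderNormOn α S φ := by
  have h1 : |φ x| ≤ supNormOn S φ :=
    le_csSup (hS.bddAbove_image (h.continuousOn hα).abs) (mem_image_of_mem _ hx)
  exact h1.trans (le_add_of_nonneg_right (holderSemiOn_nonneg α S φ))

theorem IsHolderOn.abs_sub_le_holderNormOn (h : IsHolderOn α S φ) {x y : X} (hx : x ∈ S)
    (hy : y ∈ S) : |φ x - φ y| ≤ holderNormOn α S φ * dist x y ^ α := by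
  have h1 : |φ x - φ y| ≤ holderSemiOn α S φ * dist x y ^ α := by
    rcases eq_or_ne x y with rfl | hxy
    · simpa using mul_nonneg (holderSemiOn_nonneg α S φ) (Real.rpow_nonneg le_rfl α)
    · have hd : 0 < dist x y ^ α := Real.rpow_pos_of_pos (dist_pos.2 hxy) α
      rw [← div_le_iff₀ hd]
      refine le_csInf h.exists_nonneg fun C hC => ?_
      rw [div_le_iff₀ hd]
      exact hC.2 x hx y hy
  refine h1.trans (mul_le_mul_of_nonneg_right ?_ (by positivity))
  exact le_add_of_nonneg_left (supNormOn_nonneg S φ)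

theorem holderNormOn_le {A C : ℝ} (hA : 0 ≤ A) (hC : 0 ≤ C) (h1 : ∀ x ∈ S, |φ x| ≤ A)
    (h2 : ∀ x ∈ S, ∀ y ∈ S, |φ x - φ y| ≤ C * dist x y ^ α) : holderNormOn α S φ ≤ A + C := by
  refine add_le_add (Real.sSup_le ?_ hA) (csInf_le ⟨0, fun _ h => h.1⟩ ⟨hC, h2⟩)
  rintro _ ⟨x, hx, rfl⟩
  exact h1 x hx

theorem holderNormOn_add_le (hα : 0 < α) (hS : IsCompact S) (hφ : IsHolderOn α S φ)
    (hψ : IsHolderOn α S ψ) :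
    holderNormOn α S (fun x => φ x + ψ x) ≤ holderNormOn α S φ + holderNormOn α S ψ := by
  have h1 : supNormOn S (fun x => φ x + ψ x) ≤ supNormOn S φ + supNormOn S ψ := by
    refine Real.sSup_le ?_ (add_nonneg (supNormOn_nonneg S φ) (supNormOn_nonneg S ψ))
    rintro _ ⟨x, hx, rfl⟩
    exact (abs_add_le _ _).trans (add_le_add
      (le_csSup (hS.bddAbove_image (hφ.continuousOn hα).abs) (mem_image_of_mem _ hx))
      (le_csSup (hS.bddAbove_image (hψ.continuousOn hα).abs) (mem_image_of_mem _ hx)))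
  have h2 : holderSemiOn α S (fun x => φ x + ψ x) ≤ holderSemiOn α S φ + holderSemiOn α S ψ := by
    rw [← sub_le_iff_le_add]
    refine le_csInf hφ.exists_nonneg fun C hC => ?_
    rw [sub_le_iff_le_add, ← sub_le_iff_le_add']
    refine le_csInf hψ.exists_nonneg fun D hD => ?_
    rw [sub_le_iff_le_add']
    refine csInf_le ⟨0, fun _ h => h.1⟩ ⟨add_nonneg hC.1 hD.1, fun x hx y hy => ?_⟩
    calc |φ x + ψ x - (φ y + ψ y)| = |(φ x - φ y) + (ψ x - ψ y)| := by ring_nf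
      _ ≤ |φ x - φ y| + |ψ x - ψ y| := abs_add_le _ _
      _ ≤ (C + D) * dist x y ^ α := by linarith [hC.2 x hx y hy, hD.2 x hx y hy]
  unfold holderNormOn
  linarith

theorem abs_infDist_rpow_sub_le (hα : 0 < α) (hα1 : α ≤ 1) (O : Set X) (x y : X) :
    |Metric.infDist x O ^ α - Metric.infDist y O ^ α| ≤ dist x y ^ α := by
  have key : ∀ x y : X, Metric.infDist x O ^ α ≤ Metric.infDist y O ^ α + dist x y ^ α :=
    fun x y => (Real.rpow_le_rpow Metric.infDist_nonneg
      Metric.infDist_le_infDist_add_dist hα.le).trans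
      (Real.rpow_add_le_add_rpow Metric.infDist_nonneg dist_nonneg hα.le hα1)
  rw [abs_sub_le_iff]
  have h := key y x
  rw [dist_comm] at h
  constructor <;> linarith [key x y]

end HolderNorm

theorem HasLockingOn.exists_radius {α : ℝ} (hα : 0 < α) {f : ℝ → ℝ} {S : Set ℝ}
    (hS : IsCompact S) {φ : ℝ → ℝ} (hφ : IsHolderOn α S φ) (h : HasLockingOn α f S φ) :
    ∃ ε > (0 : ℝ), ∀ ψ : ℝ → ℝ, IsHolderOn α S ψ → holderNormOn α S (fun x => ψ x - φ x) < ε →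
      HasLockingOn α f S ψ := by
  obtain ⟨⟨x, hx, p, hp, hxp, hmax⟩, ε, hε, hlock⟩ := h
  refine ⟨ε / 2, half_pos hε, fun ψ hψ hψφ => ?_⟩
  have h1 := hlock ψ hψ (by linarith)
  refine ⟨⟨x, hx, p, hp, hxp, h1.trans hmax⟩, ε / 2, half_pos hε, fun χ hχ hχψ => ?_⟩
  rw [h1]
  refine hlock χ hχ ?_
  have h2 := holderNormOn_add_le hα hS (hχ.sub hψ) (hψ.sub hφ)
  simp only [sub_add_sub_cancel] at h2
  linarith

theorem exists_stable_maximizing_orbit {f : ℝ → ℝ} {a b : ℝ} {K : Set ℝ} (hab : a < b)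
    (hf : ContDiffOn ℝ 1 f (Icc a b)) (hmaps : MapsTo f (Icc a b) (Icc a b))
    (hfa : f a ∈ ({a, b} : Set ℝ)) (hfb : f b ∈ ({a, b} : Set ℝ))
    (hhyp : IsHyperbolicOn f (Icc a b) K) {α : ℝ} (hα : 0 < α) (hα1 : α ≤ 1) {φ : ℝ → ℝ}
    (hφ : IsHolderOn α (Icc a b) φ) {ε : ℝ} (hε : 0 < ε) :
    ∃ n, ∃ z ∈ Icc a b, 0 < n ∧ f^[n] z = z ∧ ∃ δ > 0, ∀ e : ℝ → ℝ, IsHolderOn α (Icc a b) e →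
      holderNormOn α (Icc a b) e < δ →
      maxMeasuresOn f (Icc a b)
        (fun x => φ x - 2 * ε * Metric.infDist x (range fun i => f^[i] z) ^ α + e x) =
        {orbitMeasure ((Finset.range n).image fun i => f^[i] z)} := by
  obtain ⟨C, hC0, hC⟩ := hφ.exists_nonneg
  obtain ⟨n, z, hz, hn, hnz, δ, hδ, h⟩ :=
    exists_interval_locking_orbit hab hf hmaps hfa hfb hhyp hα hα1 hC0 hC hε
  refine ⟨n, z, hz, hn, hnz, δ, hδ, fun e he heδ => ?_⟩
  set O := range fun i => f^[i] z with hO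
  set ν := orbitMeasure ((Finset.range n).image fun i => f^[i] z) with hν
  set q : ℝ → ℝ := fun x => Metric.infDist x O ^ α with hq
  set ψ : ℝ → ℝ := fun x => φ x - 2 * ε * q x + e x with hψ
  obtain ⟨B, hB⟩ := h e (fun x hx => (he.abs_le_holderNormOn hα isCompact_Icc hx).trans heδ.le)
    fun x hx y hy => (he.abs_sub_le_holderNormOn hx hy).trans (by gcongr)
  have hn0 : (0 : ℝ) < n := Nat.cast_pos.2 hn
  have hfc := hf.continuousOn
  have hqc : Continuous q :=
    (Metric.continuous_infDist_pt O).rpow_const fun _ => Or.inr hα.le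
  have hψc : ContinuousOn ψ (Icc a b) := ((hφ.continuousOn hα).sub
    (hqc.const_mul (2 * ε)).continuousOn).add (he.continuousOn hα)
  have hgc : ContinuousOn (fun x => ψ x + ε * q x) (Icc a b) :=
    hψc.add (hqc.const_mul ε).continuousOn
  have hg : (fun x => φ x - ε * Metric.infDist x O ^ α + e x) = fun x => ψ x + ε * q x := by
    funext x
    simp only [hψ, hq]
    ring
  rw [hg] at hB
  have hνinv : IsInvProbOn f (Icc a b) ν := isInvProbOn_orbitMeasure hmaps hn hnz hz
  have hqO : ∀ i, q (f^[i] z) = 0 := fun i => by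
    simp only [hq]
    rw [Metric.infDist_zero_of_mem (s := O) ⟨i, rfl⟩, Real.zero_rpow hα.ne']
  have hzsum : birkhoffSum f (fun x => ψ x + ε * q x) n z = n * ∫ x, ψ x ∂ν := by
    rw [hν, mul_integral_orbitMeasure hab.le hfc hmaps hn hnz hz hψc]
    refine Finset.sum_congr rfl fun i _ => ?_
    simp only [hqO, mul_zero, add_zero]
  have hq0 : ∀ x, 0 ≤ q x := fun x => Real.rpow_nonneg Metric.infDist_nonneg α
  have hle : ∀ μ, IsInvProbOn f (Icc a b) μ → ∫ x, ψ x ∂μ + ε * ∫ x, q x ∂μ ≤ ∫ x, ψ x ∂ν := by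
    intro μ hμ
    have h1 := hμ.mul_integral_le hab.le hfc hmaps hgc (hμ.ae_mem_core hab.le hfc hmaps hhyp) hB
    rw [hzsum, integral_add (hμ.integrable_of_continuousOn hψc)
      ((hμ.integrable_of_continuousOn hqc.continuousOn).const_mul ε), integral_const_mul] at h1
    exact le_of_mul_le_mul_left h1 hn0
  have hmax : maxErgAvgOn f (Icc a b) ψ = ∫ x, ψ x ∂ν := by
    refine IsGreatest.csSup_eq ⟨⟨ν, hνinv, rfl⟩, ?_⟩
    rintro _ ⟨μ, hμ, rfl⟩
    have := mul_nonneg hε.le (integral_nonneg (μ := μ) hq0)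
    linarith [hle μ hμ]
  refine Subset.antisymm ?_ (singleton_subset_iff.2 ⟨hνinv, hmax.symm⟩)
  rintro μ ⟨hμ, hμmax⟩
  rw [hmax] at hμmax
  have hqint : ∫ x, q x ∂μ = 0 := by
    refine le_antisymm ?_ (integral_nonneg hq0)
    have h1 := hle μ hμ
    rw [hμmax, add_le_iff_nonpos_right] at h1
    exact nonpos_of_mul_nonpos_right h1 hε
  have hae := (integral_eq_zero_iff_of_nonneg hq0
    (hμ.integrable_of_continuousOn hqc.continuousOn)).1 hqint
  refine hμ.eq_orbitMeasure hmaps hnz hz ?_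
  filter_upwards [hae] with x hx
  refine (mem_image_iterate_iff hn hnz).2 ?_
  have h0 : Metric.infDist x O = 0 :=
    (Real.rpow_eq_zero Metric.infDist_nonneg hα.ne').1 hx
  exact ((finite_range_iterate hn hnz).isClosed.mem_iff_infDist_zero ⟨z, 0, rfl⟩).2 h0

theorem exists_hasLockingOn_near {f : ℝ → ℝ} {a b : ℝ} {K : Set ℝ} (hab : a < b)
    (hf : ContDiffOn ℝ 1 f (Icc a b)) (hmaps : MapsTo f (Icc a b) (Icc a b))
    (hfa : f a ∈ ({a, b} : Set ℝ)) (hfb : f b ∈ ({a, b} : Set ℝ))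
    (hhyp : IsHyperbolicOn f (Icc a b) K) {α : ℝ} (hα : 0 < α) (hα1 : α ≤ 1) {φ : ℝ → ℝ}
    (hφ : IsHolderOn α (Icc a b) φ) {ε : ℝ} (hε : 0 < ε) :
    ∃ ψ : ℝ → ℝ, IsHolderOn α (Icc a b) ψ ∧
      holderNormOn α (Icc a b) (fun x => ψ x - φ x) < ε ∧ HasLockingOn α f (Icc a b) ψ := by
  set D := (b - a) ^ α with hD
  have hD0 : 0 ≤ D := Real.rpow_nonneg (by linarith) α
  set s := ε / (4 * (D + 1)) with hs
  have hs0 : 0 < s := by positivity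
  obtain ⟨n, z, hz, hn, hnz, δ, hδ, h⟩ :=
    exists_stable_maximizing_orbit hab hf hmaps hfa hfb hhyp hα hα1 hφ hs0
  set q : ℝ → ℝ := fun x => Metric.infDist x (range fun i => f^[i] z) ^ α with hq
  have hqH : ∀ x y, |q x - q y| ≤ dist x y ^ α := abs_infDist_rpow_sub_le hα hα1 _
  have hqHol : IsHolderOn α (Icc a b) q := ⟨1, fun x _ y _ => by simpa using hqH x y⟩
  have hψ : IsHolderOn α (Icc a b) fun x => φ x - 2 * s * q x := hφ.sub (hqHol.const_mul _)
  have hqD : ∀ x ∈ Icc a b, |q x| ≤ D := by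
    intro x hx
    rw [abs_of_nonneg (Real.rpow_nonneg Metric.infDist_nonneg α)]
    refine Real.rpow_le_rpow Metric.infDist_nonneg ?_ hα.le
    refine (Metric.infDist_le_dist_of_mem (mem_range_self 0)).trans ?_
    exact Real.dist_le_of_mem_Icc hx hz
  have hbase : maxMeasuresOn f (Icc a b) (fun x => φ x - 2 * s * q x) =
      {orbitMeasure ((Finset.range n).image fun i => f^[i] z)} := by
    have h0 : IsHolderOn α (Icc a b) fun _ => (0 : ℝ) := by simpa using hφ.const_mul 0
    have hnorm0 : holderNormOn α (Icc a b) (fun _ => (0 : ℝ)) ≤ 0 + 0 :=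
      holderNormOn_le le_rfl le_rfl (by simp) (by simp)
    simpa using h _ h0 (by linarith)
  refine ⟨_, hψ, ?_, ⟨z, hz, n, hn, hnz, ?_⟩, δ, hδ, fun χ hχ hχδ => ?_⟩
  · have hnorm : holderNormOn α (Icc a b) (fun x => φ x - 2 * s * q x - φ x) ≤
        2 * s * D + 2 * s := by
      refine holderNormOn_le (by positivity) (by positivity) (fun x hx => ?_) fun x _ y _ => ?_
      · rw [sub_sub_cancel_left, abs_neg, abs_mul, abs_of_pos (by positivity)]
        gcongr
        exact hqD x hx
      · rw [sub_sub_cancel_left, sub_sub_cancel_left, neg_sub_neg, ← mul_sub, abs_mul,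
          abs_of_pos (by positivity), abs_sub_comm]
        gcongr
        exact hqH x y
    have hval : 2 * s * D + 2 * s = ε / 2 := by
      rw [hs]
      field_simp
      ring
    linarith
  · exact hbase
  · have h1 := h _ (hχ.sub hψ) hχδ
    simp only [hq, add_sub_cancel] at h1
    exact h1.trans hbase.symm

/-- **Individual typical periodic optimization for endpoint-preserving
hyperbolic `C^r` interval maps**: the locking set is open and dense in
`C^α([a,b], ℝ)`. -/
theorem locking_set_open_dense_for_hyperbolic_interval_map
    (r : ℕ) (hr : 1 ≤ r) (α : ℝ) (hα0 : 0 < α) (hα1 : α ≤ 1)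
    (a b : ℝ) (hab : a < b) (f : ℝ → ℝ)
    (hf : ContDiffOn ℝ r f (Icc a b))
    (hmaps : MapsTo f (Icc a b) (Icc a b))
    (hfa : f a ∈ ({a, b} : Set ℝ)) (hfb : f b ∈ ({a, b} : Set ℝ))
    (K : Set ℝ) (hhyp : IsHyperbolicOn f (Icc a b) K) :
    (∀ φ : ℝ → ℝ, IsHolderOn α (Icc a b) φ → HasLockingOn α f (Icc a b) φ →
      ∃ ε > (0:ℝ), ∀ ψ : ℝ → ℝ, IsHolderOn α (Icc a b) ψ →
        holderNormOn α (Icc a b) (fun x => ψ x - φ x) < ε →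
        HasLockingOn α f (Icc a b) ψ) ∧
    (∀ φ : ℝ → ℝ, IsHolderOn α (Icc a b) φ → ∀ ε > (0:ℝ),
      ∃ ψ : ℝ → ℝ, IsHolderOn α (Icc a b) ψ ∧
        holderNormOn α (Icc a b) (fun x => ψ x - φ x) < ε ∧
        HasLockingOn α f (Icc a b) ψ) := by
  have hf1 : ContDiffOn ℝ 1 f (Icc a b) := hf.of_le (by exact_mod_cast hr)
  exact ⟨fun φ hφ hlock => hlock.exists_radius hα0 isCompact_Icc hφ, fun φ hφ ε hε =>
    exists_hasLockingOn_near hab hf1 hmaps hfa hfb hhyp hα0 hα1 hφ hε⟩
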